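/- arXiv:1304.6589 — 10 statements merged into one kernel-verified Lean document; each statement's English description precedes it below -/
import Mathlib

section
/- Let R be a finite ring admitting a generating character χ. Define ω : R → ℂ by ω(r) = 1 − (1/|R^×|) · Σ_{u ∈ R^×} χ(r·u). Then: (i) ω(0) = 0; (ii) ω(x) = ω(y) whenever the left ideals Rx = {r·x : r ∈ R} and Ry coincide; (iii) Σ_{y ∈ Rx} ω(y) = |Rx| for every x ∈ R \ {0}. In other words, ω is the normalized homogeneous weight on R (homogeneous weight with average value γ = 1). -/
/-- If the kernel of `χ` contains no nonzero left ideal, then every additive character of `R` has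
the form `a ↦ χ (a * w)`. -/
theorem AddChar.exists_eq_mul_right_of_generating {R : Type*} [Ring R] [Finite R]
    (χ : AddChar R ℂ) (hgen : ∀ I : Ideal R, (∀ a ∈ I, χ a = 1) → I = ⊥) (ψ : AddChar R ℂ) :
    ∃ w : R, ∀ a, ψ a = χ (a * w) := by
  cases nonempty_fintype R
  let F : R → AddChar R ℂ := fun w => χ.compAddMonoidHom (AddMonoidHom.mulRight w)
  have hF : Function.Injective F := by
    intro w z h
    have h1 : Ideal.span {w - z} = ⊥ := by
      refine hgen _ fun a ha => ?_
      obtain ⟨r, rfl⟩ := Ideal.mem_span_singleton'.mp ha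
      have h2 : χ (r * w) = χ (r * z) := DFunLike.congr_fun h r
      rw [mul_sub, AddChar.map_sub_eq_div, h2, div_self (χ.val_isUnit _).ne_zero]
    exact sub_eq_zero.mp (Ideal.span_singleton_eq_bot.mp h1)
  have hcard : Nat.card R = Nat.card (AddChar R ℂ) := by
    rw [Nat.card_eq_fintype_card, Nat.card_eq_fintype_card, AddChar.card_eq]
  obtain ⟨w, hw⟩ := (hF.bijective_of_nat_card_le hcard.ge).2 ψ
  exact ⟨w, fun a => (DFunLike.congr_fun hw a).symm⟩

/-- The kernel of a (left) generating character contains no nonzero principal right ideal. -/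
theorem AddChar.eq_zero_of_forall_mul_eq_one {R : Type*} [Ring R] [Finite R]
    (χ : AddChar R ℂ) (hgen : ∀ I : Ideal R, (∀ a ∈ I, χ a = 1) → I = ⊥) {z : R}
    (hz : ∀ s, χ (z * s) = 1) : z = 0 := by
  by_contra h
  obtain ⟨ψ, hψ⟩ := AddChar.exists_apply_ne_zero.mpr h
  obtain ⟨w, hw⟩ := χ.exists_eq_mul_right_of_generating hgen ψ
  exact hψ (by rw [hw, hz])

open Classical in
/-- The sum of `r ↦ χ (x * r)` over a right ideal is determined by the right annihilator of `x`. -/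
theorem AddChar.sum_rightIdeal_eq {R : Type*} [Ring R] [Fintype R]
    (χ : AddChar R ℂ) (hgen : ∀ I : Ideal R, (∀ a ∈ I, χ a = 1) → I = ⊥)
    (J : Submodule Rᵐᵒᵖ R) (x : R) :
    ∑ r with r ∈ J, χ (x * r) = if ∀ r ∈ J, x * r = 0 then (Fintype.card J : ℂ) else 0 := by
  let ψ : AddChar J ℂ :=
    χ.compAddMonoidHom ((AddMonoidHom.mulLeft x).comp J.toAddSubgroup.subtype)
  have hψ : ψ = 0 ↔ ∀ r ∈ J, x * r = 0 := by
    constructor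
    · intro h r hr
      refine χ.eq_zero_of_forall_mul_eq_one hgen fun s => ?_
      have : χ (x * (r * s)) = 1 :=
        DFunLike.congr_fun h (⟨r * s, J.smul_mem (MulOpposite.op s) hr⟩ : J)
      rwa [mul_assoc]
    · intro h
      ext r
      change χ (x * r) = 1
      rw [h r r.2, χ.map_zero_eq_one]
  rw [Finset.sum_subtype (p := fun r => r ∈ J) _ (by simp) fun r => χ (x * r)]
  simp only [← hψ]
  exact AddChar.sum_eq_ite ψ

open Classical in
/-- The sum of `r ↦ χ (x * r)` over the generators of a principal right ideal is determined by the
right annihilator of `x`. -/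
theorem AddChar.sum_rightIdeal_generators_eq {R : Type*} [Ring R] [Fintype R]
    (χ : AddChar R ℂ) (hgen : ∀ I : Ideal R, (∀ a ∈ I, χ a = 1) → I = ⊥) {x y : R}
    (hxy : ∀ r, x * r = 0 ↔ y * r = 0) (J : Submodule Rᵐᵒᵖ R) :
    ∑ r with Submodule.span Rᵐᵒᵖ {r} = J, χ (x * r) =
      ∑ r with Submodule.span Rᵐᵒᵖ {r} = J, χ (y * r) := by
  have := Fintype.ofFinite (Submodule Rᵐᵒᵖ R)
  induction J using WellFoundedLT.induction with
  | ind J ih =>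
    have split (z : R) : ∑ r with r ∈ J, χ (z * r) =
        ∑ r with Submodule.span Rᵐᵒᵖ {r} = J, χ (z * r) +
          ∑ K with K < J, ∑ r with Submodule.span Rᵐᵒᵖ {r} = K, χ (z * r) := by
      have hle : (Finset.univ.filter fun K => K ≤ J) =
          insert J (Finset.univ.filter fun K => K < J) := by
        ext K
        simp [le_iff_eq_or_lt]
      rw [← Finset.sum_insert (f := fun K => ∑ r with Submodule.span Rᵐᵒᵖ {r} = K, χ (z * r))
        (by simp), ← hle, ← Finset.sum_fiberwise_of_maps_to (t := Finset.univ.filter fun K => K ≤ J)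
        (g := fun r => Submodule.span Rᵐᵒᵖ {r}) (by simp)]
      refine Finset.sum_congr rfl fun K hK => Finset.sum_congr ?_ fun _ _ => rfl
      ext r
      simp only [Finset.mem_filter, Finset.mem_univ, true_and] at hK ⊢
      refine and_iff_right_of_imp fun h => hK ?_
      exact h ▸ Submodule.mem_span_singleton_self r
    have htotal : ∑ r with r ∈ J, χ (x * r) = ∑ r with r ∈ J, χ (y * r) := by
      simp only [χ.sum_rightIdeal_eq hgen, hxy]
    rw [split x, split y, Finset.sum_congr rfl fun K hK => ih K (by simpa using hK)] at htotal
    exact add_right_cancel htotal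

/-- An element of a finite ring is a unit if and only if it generates the unit right ideal. -/
theorem span_op_singleton_eq_top_iff_isUnit {R : Type*} [Ring R] [Finite R] {r : R} :
    Submodule.span Rᵐᵒᵖ {r} = ⊤ ↔ IsUnit r := by
  constructor
  · intro h
    obtain ⟨s, hs⟩ := Submodule.mem_span_singleton.mp (h ▸ Submodule.mem_top : (1 : R) ∈ _)
    exact IsUnit.of_mul_eq_one s.unop hs
  · rintro ⟨u, rfl⟩
    refine eq_top_iff.mpr fun a _ => Submodule.mem_span_singleton.mpr ?_
    exact ⟨MulOpposite.op (↑u⁻¹ * a), by simp⟩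

/-- The sum of `u ↦ χ (x * u)` over the units is determined by the right annihilator of `x`. -/
theorem AddChar.sum_units_eq {R : Type*} [Ring R] [Fintype R] [Fintype Rˣ]
    (χ : AddChar R ℂ) (hgen : ∀ I : Ideal R, (∀ a ∈ I, χ a = 1) → I = ⊥) {x y : R}
    (hxy : ∀ r, x * r = 0 ↔ y * r = 0) :
    ∑ u : Rˣ, χ (x * u) = ∑ u : Rˣ, χ (y * u) := by
  classical
  have key (z : R) : ∑ u : Rˣ, χ (z * u) =
      ∑ r with Submodule.span Rᵐᵒᵖ {r} = ⊤, χ (z * r) := by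
    refine Finset.sum_bij (fun u _ => (u : R)) ?_ ?_ ?_ fun _ _ => rfl
    · exact fun u _ => by simpa using span_op_singleton_eq_top_iff_isUnit.mpr u.isUnit
    · exact fun u _ v _ h => Units.ext h
    · intro r hr
      obtain ⟨u, hu⟩ := span_op_singleton_eq_top_iff_isUnit.mp (Finset.mem_filter.mp hr).2
      exact ⟨u, Finset.mem_univ _, hu⟩
  rw [key, key, χ.sum_rightIdeal_generators_eq hgen hxy]

/-- A generating character, translated by a unit, sums to zero over a nonzero principal left
ideal. -/
theorem AddChar.sum_leftIdeal_mul_unit_eq_zero {R : Type*} [Ring R] [Fintype R] [DecidableEq R]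
    (χ : AddChar R ℂ) (hgen : ∀ I : Ideal R, (∀ a ∈ I, χ a = 1) → I = ⊥) {x : R} (hx : x ≠ 0)
    (u : Rˣ) : ∑ y ∈ Finset.image (fun r => r * x) Finset.univ, χ (y * u) = 0 := by
  classical
  let ψ : AddChar (Ideal.span {x}) ℂ := χ.compAddMonoidHom
    ((AddMonoidHom.mulRight (u : R)).comp (Submodule.toAddSubgroup (Ideal.span {x})).subtype)
  have hψ : ψ ≠ 0 := by
    intro h
    have h1 : Ideal.span {x * (u : R)} = ⊥ := by
      refine hgen _ fun a ha => ?_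
      obtain ⟨r, rfl⟩ := Ideal.mem_span_singleton'.mp ha
      rw [← mul_assoc]
      exact DFunLike.congr_fun h
        (⟨r * x, Ideal.mem_span_singleton'.mpr ⟨r, rfl⟩⟩ : Ideal.span {x})
    exact hx (by simpa using Ideal.span_singleton_eq_bot.mp h1)
  rw [Finset.sum_subtype (p := fun r => r ∈ Ideal.span {x}) _
    (by simp [Ideal.mem_span_singleton']) fun y => χ (y * u)]
  exact AddChar.sum_eq_zero_iff_ne_zero.mpr hψ


/-- Let `R` be a finite ring with a generating character `χ` (an additive
character whose kernel contains no nonzero left ideal).  Define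
`ω r = 1 − (1/|Rˣ|) · Σ_{u ∈ Rˣ} χ(r·u)`.  Then `ω` is the normalized homogeneous weight:
(i) `ω 0 = 0`; (ii) `ω x = ω y` whenever `Rx = Ry`; (iii) `Σ_{y ∈ Rx} ω y = |Rx|` for all
nonzero `x`. -/
theorem homogeneous_weight_formula {R : Type*} [Ring R] [Fintype R] [DecidableEq R]
    (χ : AddChar R ℂ)
    (hgen : ∀ I : Ideal R, (∀ a ∈ I, χ a = 1) → I = ⊥)
    (ω : R → ℂ)
    (hω : ∀ r : R, ω r = 1 - (1 / (Fintype.card Rˣ : ℂ)) * ∑ u : Rˣ, χ (r * (u : R))) :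
    ω 0 = 0 ∧
    (∀ x y : R, Finset.image (fun r => r * x) Finset.univ
        = Finset.image (fun r => r * y) Finset.univ → ω x = ω y) ∧
    (∀ x : R, x ≠ 0 →
      ∑ y ∈ Finset.image (fun r => r * x) Finset.univ, ω y
        = ((Finset.image (fun r => r * x) Finset.univ).card : ℂ)) := by
  refine ⟨?_, fun x y hxy => ?_, fun x hx => ?_⟩
  · simp [hω]
  · have hx : x ∈ Finset.image (fun r => r * y) Finset.univ :=
      hxy ▸ Finset.mem_image.mpr ⟨1, Finset.mem_univ _, one_mul x⟩
    have hy : y ∈ Finset.image (fun r => r * x) Finset.univ :=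
      hxy.symm ▸ Finset.mem_image.mpr ⟨1, Finset.mem_univ _, one_mul y⟩
    obtain ⟨a, -, ha⟩ := Finset.mem_image.mp hx
    obtain ⟨b, -, hb⟩ := Finset.mem_image.mp hy
    have hann (r : R) : x * r = 0 ↔ y * r = 0 :=
      ⟨fun h => by rw [← hb, mul_assoc, h, mul_zero],
        fun h => by rw [← ha, mul_assoc, h, mul_zero]⟩
    rw [hω, hω, χ.sum_units_eq hgen hann]
  · simp only [hω]
    rw [Finset.sum_sub_distrib, ← Finset.mul_sum, Finset.sum_comm]
    simp [χ.sum_leftIdeal_mul_unit_eq_zero hgen hx]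
end

section
/- Let R be a finite ring and let χ be an additive character of R such that the only left ideal of R contained in {a ∈ R : χ(a) = 1} is the zero ideal and the only right ideal of R contained in {a ∈ R : χ(a) = 1} is the zero ideal (χ is a two-sided generating character). Then for every r ∈ R, Σ_{u ∈ R^×} χ(r·u) = Σ_{u ∈ R^×} χ(u·r). -/
/-- If no nonzero left ideal lies in the kernel of `χ`, every additive character of `R` is
`x ↦ χ (x * b)` for a unique `b`. -/
theorem AddChar.bijective_comp_mulRight {R : Type*} [Ring R] [Finite R] (χ : AddChar R ℂ)
    (hχ : ∀ S : AddSubgroup R, (∀ s ∈ S, ∀ r : R, r * s ∈ S) → (∀ s ∈ S, χ s = 1) → S = ⊥) :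
    Function.Bijective fun b : R ↦ χ.compAddMonoidHom (AddMonoidHom.mulRight b) := by
  have := Fintype.ofFinite R
  rw [Fintype.bijective_iff_injective_and_card]
  refine ⟨fun b c hbc ↦ ?_, ?_⟩
  · have h (x : R) : χ (x * (b - c)) = 1 := by
      have hx : χ (x * b) = χ (x * c) := DFunLike.congr_fun hbc x
      rw [mul_sub, AddChar.map_sub_eq_div, hx, div_self (χ.val_isUnit _).ne_zero]
    have hS := hχ (AddMonoidHom.mulRight (b - c)).range
      (by rintro _ ⟨x, rfl⟩ r; exact ⟨r * x, mul_assoc _ _ _⟩)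
      (by rintro _ ⟨x, rfl⟩; exact h x)
    have hmem : b - c ∈ (AddMonoidHom.mulRight (b - c)).range := ⟨1, one_mul _⟩
    rw [hS, AddSubgroup.mem_bot] at hmem
    exact sub_eq_zero.mp hmem
  · exact AddChar.card_eq.symm

/-- If no nonzero right ideal lies in the kernel of `χ`, then `a` is determined by the
character `x ↦ χ (a * x)`. -/
theorem AddChar.eq_of_forall_mul_left {R : Type*} [Ring R] (χ : AddChar R ℂ)
    (hχ : ∀ S : AddSubgroup R, (∀ s ∈ S, ∀ r : R, s * r ∈ S) → (∀ s ∈ S, χ s = 1) → S = ⊥)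
    {a b : R} (hab : ∀ x, χ (a * x) = χ (b * x)) : a = b := by
  have h (x : R) : χ ((a - b) * x) = 1 := by
    rw [sub_mul, AddChar.map_sub_eq_div, hab, div_self (χ.val_isUnit _).ne_zero]
  have hS := hχ (AddMonoidHom.mulLeft (a - b)).range
    (by rintro _ ⟨x, rfl⟩ r; exact ⟨x * r, (mul_assoc _ _ _).symm⟩)
    (by rintro _ ⟨x, rfl⟩; exact h x)
  have hmem : a - b ∈ (AddMonoidHom.mulLeft (a - b)).range := ⟨1, mul_one _⟩
  rw [hS, AddSubgroup.mem_bot] at hmem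
  exact sub_eq_zero.mp hmem

/-- The Nakayama automorphism of a finite ring with a two-sided generating character,
as a multiplicative equivalence. -/
theorem AddChar.exists_mulEquiv_apply_mul_comm {R : Type*} [Ring R] [Finite R]
    (χ : AddChar R ℂ)
    (hleft : ∀ S : AddSubgroup R, (∀ s ∈ S, ∀ r : R, r * s ∈ S) →
      (∀ s ∈ S, χ s = 1) → S = ⊥)
    (hright : ∀ S : AddSubgroup R, (∀ s ∈ S, ∀ r : R, s * r ∈ S) →
      (∀ s ∈ S, χ s = 1) → S = ⊥) :
    ∃ σ : R ≃* R, ∀ a x, χ (a * x) = χ (x * σ a) := by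
  have hbij := χ.bijective_comp_mulRight hleft
  choose σ hσ using fun a ↦ hbij.surjective (χ.compAddMonoidHom (AddMonoidHom.mulLeft a))
  have key (a x : R) : χ (a * x) = χ (x * σ a) := (DFunLike.congr_fun (hσ a) x).symm
  have hinj : Function.Injective σ := fun a b hab ↦
    χ.eq_of_forall_mul_left hright fun x ↦ by rw [key a, key b, hab]
  have hmul (a b : R) : σ (a * b) = σ a * σ b := hbij.injective <| DFunLike.ext _ _ fun x ↦ by
    change χ (x * σ (a * b)) = χ (x * (σ a * σ b))
    rw [← key, mul_assoc, key, mul_assoc, key, mul_assoc]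
  exact ⟨MulEquiv.ofBijective (MulHom.mk σ hmul) (Finite.injective_iff_bijective.mp hinj), key⟩


/-- Let `R` be a finite ring and `χ` a two-sided generating character
(the only left ideal contained in `{a : χ a = 1}` is zero, and likewise for right ideals).
Then for every `r ∈ R`, `Σ_{u ∈ Rˣ} χ(r·u) = Σ_{u ∈ Rˣ} χ(u·r)`. -/
theorem char_sum_units_left_eq_right {R : Type*} [Ring R] [Fintype R] [DecidableEq R]
    (χ : AddChar R ℂ)
    (hgenLeft : ∀ S : AddSubgroup R, (∀ s ∈ S, ∀ r : R, r * s ∈ S) →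
      (∀ s ∈ S, χ s = 1) → S = ⊥)
    (hgenRight : ∀ S : AddSubgroup R, (∀ s ∈ S, ∀ r : R, s * r ∈ S) →
      (∀ s ∈ S, χ s = 1) → S = ⊥)
    (r : R) :
    ∑ u : Rˣ, χ (r * (u : R)) = ∑ u : Rˣ, χ ((u : R) * r) := by
  obtain ⟨σ, hσ⟩ := χ.exists_mulEquiv_apply_mul_comm hgenLeft hgenRight
  exact (Fintype.sum_equiv (Units.mapEquiv σ).toEquiv _ _ fun u ↦ hσ u r).symm
end

section
/- Let R_1, …, R_t be finite rings and for each i let ω_i be a normalized homogeneous weight on R_i. Then the function ω on the product ring R = R_1 × ⋯ × R_t defined by ω(a_1, …, a_t) = 1 − ∏_{i=1}^t (1 − ω_i(a_i)) is a normalized homogeneous weight on R. -/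
/-- `ω : R → ℝ` is a normalized homogeneous weight on the finite ring `R`:
(i) `ω 0 = 0`; (ii) `ω x = ω y` whenever the left ideals `Rx` and `Ry` coincide;
(iii) the sum of `ω` over `Rx` equals `|Rx|` for every nonzero `x`. -/
def IsNormHomWeight (R : Type*) [Ring R] [Fintype R] [DecidableEq R] (ω : R → ℝ) : Prop :=
  ω 0 = 0 ∧
  (∀ x y : R, Finset.image (fun r => r * x) Finset.univ
      = Finset.image (fun r => r * y) Finset.univ → ω x = ω y) ∧
  ∀ x : R, x ≠ 0 →
    ∑ y ∈ Finset.image (fun r => r * x) Finset.univ, ω y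
      = ((Finset.image (fun r => r * x) Finset.univ).card : ℝ)

theorem image_mul_right_pi {ι : Type*} [Fintype ι] [DecidableEq ι] {R : ι → Type*}
    [∀ i, Ring (R i)] [∀ i, Fintype (R i)] [∀ i, DecidableEq (R i)] (x : ∀ i, R i) :
    Finset.image (fun r => r * x) Finset.univ
      = Fintype.piFinset fun i => Finset.image (fun r => r * x i) Finset.univ := by
  ext y
  simp only [Finset.mem_image, Finset.mem_univ, true_and, Fintype.mem_piFinset]
  constructor
  · rintro ⟨r, rfl⟩ i
    exact ⟨r i, rfl⟩
  · intro h
    choose r hr using h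
    exact ⟨r, funext hr⟩

theorem image_mul_right_apply {ι : Type*} [Fintype ι] [DecidableEq ι] {R : ι → Type*}
    [∀ i, Ring (R i)] [∀ i, Fintype (R i)] [∀ i, DecidableEq (R i)] (x : ∀ i, R i) (i : ι) :
    (Finset.image (fun r => r * x) Finset.univ).image (fun y => y i)
      = Finset.image (fun r => r * x i) Finset.univ := by
  rw [image_mul_right_pi]
  exact Fintype.eval_image_piFinset _ i fun _ _ => Finset.univ_nonempty.image _

/-- If `ω i` is a normalized homogeneous weight on the finite ring `R i`
for each `i`, then `a ↦ 1 − ∏ i (1 − ω i (a i))` is a normalized homogeneous weight on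
the product ring `∏ i, R i`. -/
theorem isNormHomWeight_pi {ι : Type*} [Fintype ι] [DecidableEq ι] (R : ι → Type*)
    [∀ i, Ring (R i)] [∀ i, Fintype (R i)] [∀ i, DecidableEq (R i)]
    (ω : ∀ i, R i → ℝ) (hω : ∀ i, IsNormHomWeight (R i) (ω i)) :
    IsNormHomWeight (∀ i, R i) (fun a => 1 - ∏ i, (1 - ω i (a i))) := by
  refine ⟨?_, fun x y hxy => ?_, fun x hx => ?_⟩
  · simp [fun i => (hω i).1]
  · have h (i : ι) : ω i (x i) = ω i (y i) := by
      apply (hω i).2.1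
      rw [← image_mul_right_apply x i, ← image_mul_right_apply y i, hxy]
    simp only [h]
  · obtain ⟨i, hi⟩ := Function.ne_iff.mp hx
    rw [Finset.sum_sub_distrib, image_mul_right_pi, ← Finset.prod_univ_sum
      (fun i => Finset.image (fun r => r * x i) Finset.univ) (fun i a => 1 - ω i a),
      Finset.prod_eq_zero (Finset.mem_univ i)]
    · simp
    · rw [Finset.sum_sub_distrib, (hω i).2.2 (x i) hi]
      simp
end

section
/- Let R be a finite commutative local Frobenius ring with residue field of order q. Then the function ω : R → ℝ defined by ω(0) = 0, ω(a) = q/(q−1) for a ∈ soc(R) \ {0}, and ω(a) = 1 for a ∉ soc(R), is a normalized homogeneous weight on R. -/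
open IsLocalRing in
/-- In a local Artinian ring every nonzero element has a nonzero multiple in the socle. -/
theorem exists_mul_ne_zero_mem_socle {R : Type*} [CommRing R] [IsArtinianRing R] [IsLocalRing R]
    {x : R} (hx : x ≠ 0) :
    ∃ r : R, r * x ≠ 0 ∧ ∀ z ∈ maximalIdeal R, r * x * z = 0 := by
  obtain h | ⟨I, hI, hIx⟩ := eq_bot_or_exists_atom_le (Ideal.span {x})
  · exact absurd (Ideal.span_singleton_eq_bot.mp h) hx
  obtain ⟨y, hyI, hy⟩ := Submodule.exists_mem_ne_zero_of_ne_bot hI.1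
  obtain ⟨r, rfl⟩ := Ideal.mem_span_singleton'.mp (hIx hyI)
  refine ⟨r, hy, fun z hz => ?_⟩
  by_contra hne
  have hle : Ideal.span {r * x * z} ≤ I :=
    (Ideal.span_singleton_le_iff_mem I).mpr (I.mul_mem_right z hyI)
  have heq : Ideal.span {r * x * z} = I :=
    (hI.le_iff.mp hle).resolve_left (mt Ideal.span_singleton_eq_bot.mp hne)
  obtain ⟨c, hc⟩ := Ideal.mem_span_singleton'.mp (heq ▸ hyI)
  have hu : IsUnit (1 - c * z) := by
    by_contra hn
    have h1 : (1 - c * z) + c * z ∈ maximalIdeal R :=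
      add_mem ((mem_maximalIdeal _).mpr hn) (Ideal.mul_mem_left _ c hz)
    rw [sub_add_cancel] at h1
    exact (Ideal.ne_top_iff_one _).mp (maximalIdeal.isMaximal R).ne_top h1
  exact hy (hu.mul_right_eq_zero.mp (by linear_combination -hc))

open IsLocalRing in
/-- A nonzero socle element of a local ring generates an ideal equivalent to the residue field. -/
theorem card_span_singleton_of_mem_socle {R : Type*} [CommRing R] [IsLocalRing R]
    {s : R} (hs : s ≠ 0) (hsoc : ∀ z ∈ maximalIdeal R, s * z = 0) :
    Nat.card (Set.range fun r : R => r * s) = Nat.card (R ⧸ maximalIdeal R) := by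
  have hker : LinearMap.ker (LinearMap.toSpanSingleton R R s) = maximalIdeal R := by
    refine ((maximalIdeal.isMaximal R).eq_of_le ?_ fun z hz => ?_).symm
    · rw [Ideal.ne_top_iff_one]
      simpa using hs
    · simpa [mul_comm] using hsoc z hz
  rw [← hker]
  exact (Nat.card_congr (LinearMap.toSpanSingleton R R s).quotKerEquivRange.toEquiv).symm

open IsLocalRing in
/-- If the socle of a finite local ring has the cardinality of the residue field, it is contained
in every nonzero principal ideal. -/
theorem exists_mul_eq_of_mem_socle {R : Type*} [CommRing R] [Finite R] [IsLocalRing R]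
    (hcard : Nat.card {a : R // ∀ z ∈ maximalIdeal R, a * z = 0} =
      Nat.card (R ⧸ maximalIdeal R))
    {x a : R} (hx : x ≠ 0) (ha : ∀ z ∈ maximalIdeal R, a * z = 0) : ∃ r : R, r * x = a := by
  obtain ⟨t, ht, hts⟩ := exists_mul_ne_zero_mem_socle hx
  have hsub : (Set.range fun r : R => r * (t * x)) ⊆ {a | ∀ z ∈ maximalIdeal R, a * z = 0} := by
    rintro _ ⟨r, rfl⟩ z hz
    simp only [mul_assoc r, hts z hz, mul_zero]
  have heq := Set.eq_of_subset_of_ncard_le hsub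
    (hcard.trans (card_span_singleton_of_mem_socle ht hts).symm).le
  obtain ⟨r, hr⟩ : a ∈ Set.range fun r : R => r * (t * x) := heq ▸ ha
  exact ⟨r * t, by rw [mul_assoc]; exact hr⟩

/-- Let `R` be a finite commutative local Frobenius ring with residue field of
order `q` (i.e. `|R/m| = q` and the socle `soc R = {a : a·x = 0 for all x ∈ m}` has `q`
elements).  Then the function with `ω 0 = 0`, `ω a = q/(q−1)` on `soc(R) \ {0}` and
`ω a = 1` outside the socle is a normalized homogeneous weight on `R`. -/
theorem isNormHomWeight_local_frobenius {R : Type*} [CommRing R] [Fintype R] [DecidableEq R]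
    [IsLocalRing R] (q : ℕ)
    (hq : Nat.card (R ⧸ IsLocalRing.maximalIdeal R) = q)
    (hsoc : Nat.card {a : R // ∀ x ∈ IsLocalRing.maximalIdeal R, a * x = 0} = q)
    (ω : R → ℝ)
    (hω0 : ω 0 = 0)
    (hωsoc : ∀ a : R, a ≠ 0 → (∀ x ∈ IsLocalRing.maximalIdeal R, a * x = 0) →
      ω a = (q : ℝ) / ((q : ℝ) - 1))
    (hωout : ∀ a : R, ¬ (∀ x ∈ IsLocalRing.maximalIdeal R, a * x = 0) → ω a = 1) :
    IsNormHomWeight R ω := by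
  classical
  refine ⟨hω0, fun x y hxy => ?_, fun x hx => ?_⟩
  · obtain ⟨r, hr⟩ : ∃ r, r * y = x := by
      simpa using (Finset.ext_iff.mp hxy x).mp (Finset.mem_image.mpr ⟨1, by simp⟩)
    obtain ⟨s, hs⟩ : ∃ s, s * x = y := by
      simpa using (Finset.ext_iff.mp hxy y).mpr (Finset.mem_image.mpr ⟨1, by simp⟩)
    by_cases hx : x = 0
    · rw [← hs, hx, mul_zero]
    have hy : y ≠ 0 := fun h => hx (by rw [← hr, h, mul_zero])
    by_cases hxs : ∀ z ∈ IsLocalRing.maximalIdeal R, x * z = 0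
    · rw [hωsoc x hx hxs, hωsoc y hy fun z hz => by rw [← hs, mul_assoc, hxs z hz, mul_zero]]
    · rw [hωout x hxs, hωout y fun h => hxs fun z hz => by
        rw [← hr, mul_assoc, h z hz, mul_zero]]
  · set S : Finset R := {a | ∀ z ∈ IsLocalRing.maximalIdeal R, a * z = 0} with hS
    have hSmem (a : R) : a ∈ S ↔ ∀ z ∈ IsLocalRing.maximalIdeal R, a * z = 0 := by simp [hS]
    have hScard : S.card = q := by
      rw [← hsoc, Nat.card_eq_fintype_card, Fintype.card_subtype]
    have hSx : S ⊆ Finset.image (fun r => r * x) Finset.univ := fun a ha => by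
      simpa using exists_mul_eq_of_mem_socle (hsoc.trans hq.symm) hx ((hSmem a).mp ha)
    have hq1 : 1 < q := hq ▸ Finite.one_lt_card
    have hq1' : (q : ℝ) - 1 ≠ 0 := sub_ne_zero.mpr (by exact_mod_cast hq1.ne')
    have h0 : (0 : R) ∈ S := by simp [hSmem]
    have hsumS : ∑ y ∈ S, ω y = S.card := by
      rw [← Finset.sum_erase S hω0, Finset.sum_congr rfl fun a ha =>
        hωsoc a (Finset.ne_of_mem_erase ha) ((hSmem a).mp (Finset.mem_of_mem_erase ha)),
        Finset.sum_const, Finset.card_erase_of_mem h0, hScard, nsmul_eq_mul,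
        Nat.cast_pred (by omega), mul_div_cancel₀ _ hq1']
    rw [← Finset.sum_sdiff hSx, hsumS, Finset.sum_congr rfl fun a ha =>
      hωout a (mt (hSmem a).mpr (Finset.mem_sdiff.mp ha).2), Finset.sum_const, nsmul_one,
      ← Nat.cast_add, Finset.card_sdiff_add_card_eq_card hSx]
end

section
/- Let R = ∏_{i=1}^t ∏_{j=1}^{n_i} R_{i,j}, where each R_{i,j} is a finite commutative local Frobenius ring with residue field of order q_i, and q_1, …, q_t are distinct prime powers. Write a ∈ R as a = (a_1, …, a_t) with a_i = (a_{i,1}, …, a_{i,n_i}); set soc(R) := {a : a_{i,j} ∈ soc(R_{i,j}) for all i,j} and wt(a_i) := #{j : a_{i,j} ≠ 0}. Then the function ω : R → ℝ given by ω(a) = 1 − ∏_{i=1}^t (−1/(q_i−1))^{wt(a_i)} if a ∈ soc(R), and ω(a) = 1 otherwise, is a normalized homogeneous weight on R. -/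
open Classical in
/-- The local factor of `1 - ω`: `1` at `0`, `c` on the nonzero socle elements, `0` elsewhere. -/
noncomputable def socleWeight (S : Type*) [CommRing S] [IsLocalRing S] (c : ℝ) (a : S) : ℝ :=
  if a = 0 then 1
  else if ∀ x ∈ IsLocalRing.maximalIdeal S, a * x = 0 then c else 0

theorem socleWeight_congr {S : Type*} [CommRing S] [IsLocalRing S] (c : ℝ) {a b : S}
    (hab : a ∣ b) (hba : b ∣ a) : socleWeight S c a = socleWeight S c b := by
  have h0 : a = 0 ↔ b = 0 :=
    ⟨fun h => zero_dvd_iff.1 (h ▸ hab), fun h => zero_dvd_iff.1 (h ▸ hba)⟩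
  have hs : (∀ x ∈ IsLocalRing.maximalIdeal S, a * x = 0) ↔
      ∀ x ∈ IsLocalRing.maximalIdeal S, b * x = 0 := by
    obtain ⟨r, rfl⟩ := hab
    obtain ⟨s, hs⟩ := hba
    refine ⟨fun h x hx => by rw [mul_right_comm, h x hx, zero_mul], fun h x hx => ?_⟩
    rw [hs, mul_right_comm, h x hx, zero_mul]
  classical
  unfold socleWeight
  split_ifs <;> simp_all

/-- In a finite local ring, every nonzero element has a nonzero multiple in the socle. -/
theorem exists_dvd_mul_maximalIdeal_eq_zero {S : Type*} [CommRing S] [Finite S] [IsLocalRing S]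
    {x : S} (hx : x ≠ 0) :
    ∃ s, s ≠ 0 ∧ x ∣ s ∧ ∀ z ∈ IsLocalRing.maximalIdeal S, s * z = 0 := by
  obtain h | ⟨I, hI, hIx⟩ := eq_bot_or_exists_atom_le (Ideal.span {x})
  · exact absurd (Ideal.span_singleton_eq_bot.1 h) hx
  obtain ⟨s, hsI, hs⟩ := Submodule.exists_mem_ne_zero_of_ne_bot hI.1
  refine ⟨s, hs, Ideal.mem_span_singleton.1 (hIx hsI), fun z hz => ?_⟩
  by_contra hsz
  have hle : Ideal.span {s * z} ≤ I :=
    (Ideal.span_singleton_le_iff_mem I).2 (I.mul_mem_right z hsI)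
  have heq : Ideal.span {s * z} = I :=
    (hI.le_iff.1 hle).resolve_left fun h => hsz (Ideal.span_singleton_eq_bot.1 h)
  obtain ⟨r, hr⟩ := Ideal.mem_span_singleton.1 (heq ▸ hsI)
  have hu : IsUnit (1 - z * r) := by
    have := IsLocalRing.isUnit_or_isUnit_one_sub_self (z * r)
    exact this.resolve_left fun h =>
      (IsLocalRing.mem_maximalIdeal _).1 (Ideal.mul_mem_right r _ hz) h
  exact hs ((hu.mul_left_eq_zero).1 (by linear_combination hr))

/-- In a finite local Frobenius ring, every nonzero element divides every socle element. -/
theorem dvd_of_mul_maximalIdeal_eq_zero {S : Type*} [CommRing S] [Finite S] [IsLocalRing S]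
    (h : Nat.card {b : S // ∀ x ∈ IsLocalRing.maximalIdeal S, b * x = 0} ≤
      Nat.card (S ⧸ IsLocalRing.maximalIdeal S))
    {x b : S} (hx : x ≠ 0) (hb : ∀ z ∈ IsLocalRing.maximalIdeal S, b * z = 0) : x ∣ b := by
  obtain ⟨s, hs, hxs, hsoc⟩ := exists_dvd_mul_maximalIdeal_eq_zero hx
  refine hxs.trans ?_
  have hker : LinearMap.ker (LinearMap.toSpanSingleton S S s) = IsLocalRing.maximalIdeal S := by
    ext r
    rw [LinearMap.mem_ker, LinearMap.toSpanSingleton_apply, smul_eq_mul]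
    refine ⟨fun hr hu => hs (hu.mul_right_eq_zero.1 hr), fun hr => ?_⟩
    rw [mul_comm, hsoc r hr]
  have hcard : Nat.card (S ⧸ IsLocalRing.maximalIdeal S) =
      Nat.card (LinearMap.range (LinearMap.toSpanSingleton S S s)) := by
    rw [← hker]
    exact Nat.card_congr (LinearMap.quotKerEquivRange _).toEquiv
  have hsub : (LinearMap.range (LinearMap.toSpanSingleton S S s) : Set S) ⊆
      {b : S | ∀ x ∈ IsLocalRing.maximalIdeal S, b * x = 0} := by
    rintro _ ⟨r, rfl⟩ z hz
    rw [LinearMap.toSpanSingleton_apply, smul_eq_mul, mul_assoc, hsoc z hz, mul_zero]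
  have heq := Set.eq_of_subset_of_ncard_le hsub (h.trans_eq hcard) (Set.toFinite _)
  obtain ⟨r, hr⟩ := heq.ge hb
  exact ⟨r, by rw [← hr, LinearMap.toSpanSingleton_apply, smul_eq_mul, mul_comm]⟩

theorem sum_image_mul_socleWeight {S : Type*} [CommRing S] [Fintype S] [DecidableEq S]
    [IsLocalRing S] {q : ℕ} (hq1 : 1 < q)
    (hq : Nat.card (S ⧸ IsLocalRing.maximalIdeal S) = q)
    (hsoc : Nat.card {b : S // ∀ x ∈ IsLocalRing.maximalIdeal S, b * x = 0} = q)
    {x : S} (hx : x ≠ 0) :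
    ∑ y ∈ Finset.image (fun r => r * x) Finset.univ,
      socleWeight S (-1 / ((q : ℝ) - 1)) y = 0 := by
  classical
  set T := Finset.univ.filter fun b : S => ∀ x ∈ IsLocalRing.maximalIdeal S, b * x = 0 with hT
  have hTcard : T.card = q := by
    rw [← hsoc, Nat.card_eq_fintype_card, Fintype.card_subtype]
  have h0 : (0 : S) ∈ T := by simp [hT]
  have hsub : T ⊆ Finset.image (fun r => r * x) Finset.univ := by
    intro b hb
    obtain ⟨r, rfl⟩ := dvd_of_mul_maximalIdeal_eq_zero (hsoc.trans hq.symm).le hx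
      (Finset.mem_filter.1 hb).2
    exact Finset.mem_image.2 ⟨r, Finset.mem_univ r, mul_comm r x⟩
  rw [← Finset.sum_subset hsub, ← Finset.add_sum_erase T _ h0,
    Finset.sum_congr rfl (g := fun _ => -1 / ((q : ℝ) - 1)), Finset.sum_const,
    Finset.card_erase_of_mem h0, hTcard, nsmul_eq_mul, Nat.cast_sub hq1.le]
  · have : (q : ℝ) - 1 ≠ 0 := sub_ne_zero.2 (by exact_mod_cast hq1.ne')
    simp only [socleWeight, if_true, Nat.cast_one]
    field_simp
    ring
  · intro b hb
    rw [socleWeight, if_neg (Finset.ne_of_mem_erase hb),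
      if_pos (Finset.mem_filter.1 (Finset.mem_of_mem_erase hb)).2]
  · intro b _ hb
    have hb' : ¬ ∀ x ∈ IsLocalRing.maximalIdeal S, b * x = 0 := fun h =>
      hb (Finset.mem_filter.2 ⟨Finset.mem_univ b, h⟩)
    rw [socleWeight, if_neg (fun h : b = 0 => hb (h ▸ h0)), if_neg hb']

/-- The principal ideal of a finite product ring is the product of the principal ideals, so sums
of products over it factor. -/
theorem sum_image_mul_pi {ι : Type*} [Fintype ι] [DecidableEq ι] (S : ι → Type*)
    [∀ i, CommRing (S i)] [∀ i, Fintype (S i)] [∀ i, DecidableEq (S i)]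
    (f : ∀ i, S i → ℝ) (x : ∀ i, S i) :
    ∑ y ∈ Finset.image (fun r => r * x) Finset.univ, ∏ i, f i (y i) =
      ∏ i, ∑ y ∈ Finset.image (fun r => r * x i) Finset.univ, f i y := by
  rw [Finset.prod_univ_sum]
  refine Finset.sum_congr ?_ fun _ _ => rfl
  ext y
  simp only [Finset.mem_image, Finset.mem_univ, true_and, Fintype.mem_piFinset]
  refine ⟨fun ⟨r, hr⟩ i => ⟨r i, congrFun hr i⟩, fun h => ?_⟩
  choose r hr using h
  exact ⟨r, funext hr⟩

/-- Let `R = ∏_{i,j} R_{i,j}` with each `R_{i,j}` a finite commutative local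
Frobenius ring with residue field of order `q i`, the `q i` distinct prime powers.  Then
`ω(a) = 1 − ∏ i (−1/(q_i−1))^{wt(a_i)}` on the socle, `ω(a) = 1` outside, is a normalized
homogeneous weight on `R`. -/
theorem isNormHomWeight_prod_local {t : ℕ} {n : Fin t → ℕ}
    (R : (i : Fin t) → Fin (n i) → Type*)
    [∀ i j, CommRing (R i j)] [∀ i j, Fintype (R i j)] [∀ i j, DecidableEq (R i j)]
    [∀ i j, IsLocalRing (R i j)]
    (q : Fin t → ℕ) (hqpp : ∀ i, IsPrimePow (q i)) (hqdist : Function.Injective q)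
    (hq : ∀ i j, Nat.card (R i j ⧸ IsLocalRing.maximalIdeal (R i j)) = q i)
    (hsoc : ∀ i j,
      Nat.card {b : R i j // ∀ x ∈ IsLocalRing.maximalIdeal (R i j), b * x = 0} = q i)
    (ω : (∀ i, ∀ j, R i j) → ℝ)
    (hωsoc : ∀ a : ∀ i, ∀ j, R i j,
      (∀ i j, ∀ x ∈ IsLocalRing.maximalIdeal (R i j), a i j * x = 0) →
      ω a = 1 - ∏ i, (-1 / ((q i : ℝ) - 1)) ^ (Finset.univ.filter (fun j => a i j ≠ 0)).card)
    (hωout : ∀ a : ∀ i, ∀ j, R i j,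
      ¬ (∀ i j, ∀ x ∈ IsLocalRing.maximalIdeal (R i j), a i j * x = 0) → ω a = 1) :
    IsNormHomWeight (∀ i, ∀ j, R i j) ω := by
  have key : ∀ a, ω a = 1 - ∏ i, ∏ j, socleWeight (R i j) (-1 / ((q i : ℝ) - 1)) (a i j) := by
    intro a
    by_cases ha : ∀ i j, ∀ x ∈ IsLocalRing.maximalIdeal (R i j), a i j * x = 0
    · rw [hωsoc a ha]
      congr 1
      refine Finset.prod_congr rfl fun i _ => ?_
      rw [← Finset.prod_const, Finset.prod_filter]
      refine Finset.prod_congr rfl fun j _ => ?_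
      by_cases h : a i j = 0
      · simp [socleWeight, h]
      · rw [socleWeight, if_pos h, if_neg h, if_pos (ha i j)]
    · rw [hωout a ha]
      obtain ⟨i, hi⟩ := not_forall.1 ha
      obtain ⟨j, hj⟩ := not_forall.1 hi
      have h0 : a i j ≠ 0 := fun h => hj fun x _ => by rw [h, zero_mul]
      have hij : socleWeight (R i j) (-1 / ((q i : ℝ) - 1)) (a i j) = 0 := by
        rw [socleWeight, if_neg h0, if_neg hj]
      rw [Finset.prod_eq_zero (Finset.mem_univ i)
        (Finset.prod_eq_zero (Finset.mem_univ j) hij), sub_zero]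
  refine ⟨by simp [key, socleWeight], fun x y hxy => ?_, fun x hx => ?_⟩
  · have hx : x ∈ Finset.image (fun r => r * y) Finset.univ :=
      hxy ▸ Finset.mem_image.2 ⟨1, Finset.mem_univ _, one_mul x⟩
    have hy : y ∈ Finset.image (fun r => r * x) Finset.univ :=
      hxy ▸ Finset.mem_image.2 ⟨1, Finset.mem_univ _, one_mul y⟩
    obtain ⟨r, -, hr⟩ := Finset.mem_image.1 hx
    obtain ⟨s, -, hs⟩ := Finset.mem_image.1 hy
    rw [key, key]
    congr 1
    refine Finset.prod_congr rfl fun i _ => Finset.prod_congr rfl fun j _ => ?_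
    exact socleWeight_congr _ (Dvd.intro_left (s i j) (congrFun (congrFun hs i) j))
      (Dvd.intro_left (r i j) (congrFun (congrFun hr i) j))
  · obtain ⟨i, hi⟩ := Function.ne_iff.1 hx
    obtain ⟨j, hj⟩ := Function.ne_iff.1 hi
    simp only [key, Finset.sum_sub_distrib, Finset.sum_const, nsmul_eq_mul, mul_one]
    rw [sum_image_mul_pi (fun i => ∀ j, R i j)
      (fun i y => ∏ j, socleWeight (R i j) (-1 / ((q i : ℝ) - 1)) (y j)) x,
      Finset.prod_eq_zero (Finset.mem_univ i), sub_zero]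
    rw [sum_image_mul_pi (R i) (fun j => socleWeight (R i j) (-1 / ((q i : ℝ) - 1))) (x i)]
    exact Finset.prod_eq_zero (Finset.mem_univ j)
      (sum_image_mul_socleWeight (hqpp i).one_lt (hq i j) (hsoc i j) hj)
end

section
/- Let R = ∏_{i=1}^t ∏_{j=1}^{n_i} R_{i,j}, where each R_{i,j} is a finite commutative local Frobenius ring with residue field of order q_i, and q_1, …, q_t are distinct prime powers; set soc(R) := {a : a_{i,j} ∈ soc(R_{i,j}) for all i,j}. Then every normalized homogeneous weight ω on R satisfies: ω(a) = 1 if and only if a ∉ soc(R). In particular, R \ soc(R) is a single block of the partition of R induced by ω. -/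
/-- The principal ideal generated by `x`, as a finset. -/
def principalFinset {R : Type*} [Ring R] [Fintype R] [DecidableEq R] (x : R) : Finset R :=
  Finset.image (fun r => r * x) Finset.univ

section Principal

variable {R : Type*} [Ring R] [Fintype R] [DecidableEq R] {x y : R}

theorem mem_principalFinset : y ∈ principalFinset x ↔ ∃ r, r * x = y := by
  simp [principalFinset]

theorem mem_principalFinset_self (x : R) : x ∈ principalFinset x :=
  mem_principalFinset.2 ⟨1, one_mul x⟩

theorem principalFinset_subset (h : y ∈ principalFinset x) :
    principalFinset y ⊆ principalFinset x := by
  intro z hz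
  obtain ⟨r, rfl⟩ := mem_principalFinset.1 h
  obtain ⟨s, rfl⟩ := mem_principalFinset.1 hz
  exact mem_principalFinset.2 ⟨s * r, mul_assoc s r x⟩

theorem principalFinset_eq_or_card_lt (h : y ∈ principalFinset x) :
    principalFinset y = principalFinset x ∨
      (principalFinset y).card < (principalFinset x).card :=
  (principalFinset_subset h).eq_or_ssubset.imp_right Finset.card_lt_card

end Principal

/-- `f = 1 - ω` for a normalized homogeneous weight `ω`. -/
structure IsHomComplement {R : Type*} [Ring R] [Fintype R] [DecidableEq R] (f : R → ℝ) :
    Prop where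
  map_zero : f 0 = 1
  congr : ∀ x y, principalFinset x = principalFinset y → f x = f y
  sum_eq_zero : ∀ x, x ≠ 0 → ∑ y ∈ principalFinset x, f y = 0

theorem IsNormHomWeight.isHomComplement {R : Type*} [Ring R] [Fintype R] [DecidableEq R]
    {ω : R → ℝ} (h : IsNormHomWeight R ω) : IsHomComplement fun x => 1 - ω x where
  map_zero := by simp [h.1]
  congr x y hxy := by rw [h.2.1 x y hxy]
  sum_eq_zero x hx := by
    have := h.2.2 x hx
    rw [Finset.sum_sub_distrib]
    simp [principalFinset, this]

theorem IsHomComplement.unique {R : Type*} [Ring R] [Fintype R] [DecidableEq R]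
    {f g : R → ℝ} (hf : IsHomComplement f) (hg : IsHomComplement g) (x : R) : f x = g x := by
  induction hc : (principalFinset x).card using Nat.strong_induction_on generalizing x with
  | _ c ih =>
    subst hc
    rcases eq_or_ne x 0 with rfl | hx
    · rw [hf.map_zero, hg.map_zero]
    have key : ∀ y ∈ principalFinset x, f y - g y =
        if principalFinset y = principalFinset x then f x - g x else 0 := by
      intro y hy
      split_ifs with h
      · rw [hf.congr y x h, hg.congr y x h]
      · rw [ih _ ((principalFinset_eq_or_card_lt hy).resolve_left h) y rfl, sub_self]
    have hsum := Finset.sum_congr rfl key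
    rw [Finset.sum_sub_distrib, hf.sum_eq_zero x hx, hg.sum_eq_zero x hx, ← Finset.sum_filter,
      Finset.sum_const, sub_zero, nsmul_eq_mul, eq_comm, mul_eq_zero] at hsum
    refine sub_eq_zero.1 (hsum.resolve_left ?_)
    rw [Nat.cast_eq_zero, Finset.card_eq_zero]
    exact Finset.ne_empty_of_mem (Finset.mem_filter.2 ⟨mem_principalFinset_self x, rfl⟩)

theorem principalFinset_pi {ι : Type*} [Fintype ι] [DecidableEq ι] {R : ι → Type*}
    [∀ i, Ring (R i)] [∀ i, Fintype (R i)] [∀ i, DecidableEq (R i)]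
    [DecidableEq (∀ i, R i)] (x : ∀ i, R i) :
    principalFinset x = Fintype.piFinset fun i => principalFinset (x i) := by
  ext y
  simp only [mem_principalFinset, Fintype.mem_piFinset]
  refine ⟨fun ⟨r, hr⟩ i => ⟨r i, congrFun hr i⟩, fun h => ?_⟩
  choose r hr using h
  exact ⟨r, funext hr⟩

theorem IsHomComplement.pi {ι : Type*} [Fintype ι] [DecidableEq ι] {R : ι → Type*}
    [∀ i, Ring (R i)] [∀ i, Fintype (R i)] [∀ i, DecidableEq (R i)]
    [DecidableEq (∀ i, R i)] {f : ∀ i, R i → ℝ} (hf : ∀ i, IsHomComplement (f i)) :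
    IsHomComplement fun x : ∀ i, R i => ∏ i, f i (x i) where
  map_zero := Finset.prod_eq_one fun i _ => (hf i).map_zero
  congr x y hxy := by
    refine Finset.prod_congr rfl fun i _ => (hf i).congr _ _ ?_
    have hmem {x y : ∀ i, R i} (h : x ∈ principalFinset y) : x i ∈ principalFinset (y i) := by
      rw [principalFinset_pi, Fintype.mem_piFinset] at h
      exact h i
    exact (principalFinset_subset (hmem (hxy ▸ mem_principalFinset_self x))).antisymm
      (principalFinset_subset (hmem (hxy.symm ▸ mem_principalFinset_self y)))
  sum_eq_zero x hx := by
    obtain ⟨i, hi⟩ := Function.ne_iff.1 hx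
    rw [principalFinset_pi, ← Finset.prod_univ_sum]
    exact Finset.prod_eq_zero (Finset.mem_univ i) ((hf i).sum_eq_zero _ hi)

section Local

open IsLocalRing

variable {S : Type*} [CommRing S] [Fintype S] [DecidableEq S] [IsLocalRing S]

theorem exists_ne_zero_mem_socle_of_ne_zero {x : S} (hx : x ≠ 0) :
    ∃ z ∈ principalFinset x, z ≠ 0 ∧ ∀ w ∈ maximalIdeal S, z * w = 0 := by
  induction hc : (principalFinset x).card using Nat.strong_induction_on generalizing x with
  | _ c ih =>
    subst hc
    by_cases hs : ∀ w ∈ maximalIdeal S, x * w = 0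
    · exact ⟨x, mem_principalFinset_self x, hx, hs⟩
    push Not at hs
    obtain ⟨w, hw, hxw⟩ := hs
    have hmem : x * w ∈ principalFinset x := mem_principalFinset.2 ⟨w, mul_comm w x⟩
    rcases principalFinset_eq_or_card_lt hmem with h | h
    · obtain ⟨r, hr⟩ := mem_principalFinset.1 (h ▸ mem_principalFinset_self x)
      have hu : IsUnit (1 - r * w) := by
        by_contra hn
        have h1 := (maximalIdeal S).add_mem ((mem_maximalIdeal _).2 hn)
          ((maximalIdeal S).mul_mem_left r hw)
        rw [sub_add_cancel] at h1
        exact (Ideal.ne_top_iff_one _).1 (maximalIdeal.isMaximal S).ne_top h1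
      exact absurd (hu.mul_right_eq_zero.1 (by linear_combination -hr)) hx
    · obtain ⟨z, hz, h0, hs⟩ := ih _ h hxw rfl
      exact ⟨z, principalFinset_subset hmem hz, h0, hs⟩

theorem mem_principalFinset_of_mem_socle
    (hcard : Nat.card {b : S // ∀ x ∈ maximalIdeal S, b * x = 0} =
      Nat.card (S ⧸ maximalIdeal S))
    {x y : S} (hx : x ≠ 0) (hy : ∀ w ∈ maximalIdeal S, y * w = 0) :
    y ∈ principalFinset x := by
  obtain ⟨z, hz, h0, hs⟩ := exists_ne_zero_mem_socle_of_ne_zero hx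
  refine principalFinset_subset hz ?_
  have hker : LinearMap.ker (LinearMap.toSpanSingleton S S z) = maximalIdeal S := by
    ext r
    rw [LinearMap.mem_ker, LinearMap.toSpanSingleton_apply, smul_eq_mul]
    refine ⟨fun h => ?_, fun h => by rw [mul_comm, hs r h]⟩
    exact (mem_maximalIdeal r).2 fun hu => h0 (hu.mul_right_eq_zero.1 h)
  let φ : S ⧸ maximalIdeal S →ₗ[S] S :=
    (maximalIdeal S).liftQ (LinearMap.toSpanSingleton S S z) hker.ge
  have hφ (r : S) : φ (Submodule.Quotient.mk r) = r * z := rfl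
  have hinj : Function.Injective φ :=
    LinearMap.ker_eq_bot.1 (Submodule.ker_liftQ_eq_bot _ _ _ hker.le)
  have hmem (v : S ⧸ maximalIdeal S) : ∀ w ∈ maximalIdeal S, φ v * w = 0 := by
    intro w hw
    obtain ⟨r, rfl⟩ := Submodule.Quotient.mk_surjective _ v
    rw [hφ, mul_assoc, hs w hw, mul_zero]
  let ψ : S ⧸ maximalIdeal S → {b : S // ∀ x ∈ maximalIdeal S, b * x = 0} :=
    fun v => ⟨φ v, hmem v⟩
  have hψ : Function.Injective ψ := fun a b h => hinj (congrArg Subtype.val h)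
  obtain ⟨v, hv⟩ := (hψ.bijective_of_nat_card_le hcard.le).2 ⟨y, hy⟩
  obtain ⟨r, rfl⟩ := Submodule.Quotient.mk_surjective _ v
  exact mem_principalFinset.2 ⟨r, congrArg Subtype.val hv⟩

open Classical in
/-- The complement of the normalized homogeneous weight on a finite local Frobenius ring whose
residue field has order `q`. -/
noncomputable def localHomComplement (S : Type*) [CommRing S] [IsLocalRing S] (q : ℕ) (x : S) :
    ℝ :=
  if x = 0 then 1 else if ∀ w ∈ maximalIdeal S, x * w = 0 then -1 / ((q : ℝ) - 1) else 0

theorem isHomComplement_localHomComplement {q : ℕ} (hq : Nat.card (S ⧸ maximalIdeal S) = q)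
    (hsoc : Nat.card {b : S // ∀ x ∈ maximalIdeal S, b * x = 0} = q) :
    IsHomComplement (localHomComplement S q) where
  map_zero := by simp [localHomComplement]
  congr x y hxy := by
    obtain ⟨r, hr⟩ := mem_principalFinset.1 (hxy ▸ mem_principalFinset_self x)
    obtain ⟨s, hs⟩ := mem_principalFinset.1 (hxy.symm ▸ mem_principalFinset_self y)
    have h0 : x = 0 ↔ y = 0 :=
      ⟨fun h => by rw [← hs, h, mul_zero], fun h => by rw [← hr, h, mul_zero]⟩
    have h1 : (∀ w ∈ maximalIdeal S, x * w = 0) ↔ ∀ w ∈ maximalIdeal S, y * w = 0 :=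
      ⟨fun h w hw => by rw [← hs, mul_assoc, h w hw, mul_zero],
        fun h w hw => by rw [← hr, mul_assoc, h w hw, mul_zero]⟩
    simp only [localHomComplement, h0]
    congr 2
    exact propext h1
  sum_eq_zero x hx := by
    classical
    have hq1 : 1 < q := hq ▸ Finite.one_lt_card
    have hq0 : (q : ℝ) - 1 ≠ 0 := sub_ne_zero.2 (by exact_mod_cast hq1.ne')
    set T : Finset S := Finset.univ.filter fun b => ∀ w ∈ maximalIdeal S, b * w = 0 with hT
    have hTcard : T.card = q := by
      rw [← hsoc, Nat.card_eq_fintype_card, Fintype.card_subtype]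
    have hTx : T ⊆ principalFinset x := fun y hy =>
      mem_principalFinset_of_mem_socle (hsoc.trans hq.symm) hx (Finset.mem_filter.1 hy).2
    have h0T : (0 : S) ∈ T := by simp [hT]
    rw [← Finset.sum_subset hTx, ← Finset.add_sum_erase _ _ h0T,
      Finset.sum_congr rfl (g := fun _ => -1 / ((q : ℝ) - 1)), Finset.sum_const,
      Finset.card_erase_of_mem h0T, hTcard, nsmul_eq_mul, Nat.cast_pred (by omega)]
    · simp only [localHomComplement, if_true]
      field_simp
      ring
    · intro y hy
      have hy' := Finset.mem_erase.1 hy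
      rw [localHomComplement, if_neg hy'.1, if_pos (Finset.mem_filter.1 hy'.2).2]
    · intro y _ hy
      have hs : ¬ ∀ w ∈ maximalIdeal S, y * w = 0 := fun h =>
        hy (Finset.mem_filter.2 ⟨Finset.mem_univ y, h⟩)
      rw [localHomComplement, if_neg (ne_of_mem_of_not_mem h0T hy).symm, if_neg hs]

theorem localHomComplement_eq_zero_iff {S : Type*} [CommRing S] [IsLocalRing S] {q : ℕ}
    (hq : 1 < q) (x : S) :
    localHomComplement S q x = 0 ↔ ¬ ∀ w ∈ maximalIdeal S, x * w = 0 := by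
  have hq0 : (q : ℝ) - 1 ≠ 0 := sub_ne_zero.2 (by exact_mod_cast hq.ne')
  rw [localHomComplement]
  split_ifs with h0 h1
  · simp [h0]
  · exact iff_of_false (div_ne_zero (by norm_num) hq0) (not_not.2 h1)
  · exact iff_of_true rfl h1

end Local


/-- For `R = ∏_{i,j} R_{i,j}` a product of finite commutative local Frobenius
rings with residue fields of distinct prime power orders `q i`, every normalized homogeneous
weight `ω` on `R` satisfies `ω a = 1` iff `a ∉ soc(R)`. -/
theorem normHomWeight_eq_one_iff_not_mem_socle {t : ℕ} {n : Fin t → ℕ}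
    (R : (i : Fin t) → Fin (n i) → Type*)
    [∀ i j, CommRing (R i j)] [∀ i j, Fintype (R i j)] [∀ i j, DecidableEq (R i j)]
    [∀ i j, IsLocalRing (R i j)]
    (q : Fin t → ℕ) (hqpp : ∀ i, IsPrimePow (q i)) (hqdist : Function.Injective q)
    (hq : ∀ i j, Nat.card (R i j ⧸ IsLocalRing.maximalIdeal (R i j)) = q i)
    (hsoc : ∀ i j,
      Nat.card {b : R i j // ∀ x ∈ IsLocalRing.maximalIdeal (R i j), b * x = 0} = q i)
    (ω : (∀ i, ∀ j, R i j) → ℝ) (hω : IsNormHomWeight (∀ i, ∀ j, R i j) ω) :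
    ∀ a : ∀ i, ∀ j, R i j,
      ω a = 1 ↔ ¬ (∀ i j, ∀ x ∈ IsLocalRing.maximalIdeal (R i j), a i j * x = 0) := by
  intro a
  have h := hω.isHomComplement.unique (IsHomComplement.pi fun i => IsHomComplement.pi fun j =>
    isHomComplement_localHomComplement (hq i j) (hsoc i j)) a
  have hq1 (i : Fin t) : 1 < q i := (hqpp i).one_lt
  rw [eq_comm, ← sub_eq_zero, h]
  simp only [Finset.prod_eq_zero_iff, Finset.mem_univ, true_and,
    localHomComplement_eq_zero_iff (hq1 _), not_forall]
end

section
/- Let G be a finite abelian group, H a subgroup of G, and P_0, …, P_M nonempty pairwise disjoint sets whose union is H (a partition of H). Let ε denote the trivial character of G. For characters χ, χ' of G, the following are equivalent: (1) Σ_{a ∈ G\H} χ(a) = Σ_{a ∈ G\H} χ'(a) and Σ_{a ∈ P_m} χ(a) = Σ_{a ∈ P_m} χ'(a) for all m = 0, …, M; (2) one of the following holds: (i) χ = χ' = ε; (ii) χ ≠ ε, χ' ≠ ε, and both χ and χ' are trivial on H; (iii) the restrictions of χ and χ' to H are both nontrivial and Σ_{a ∈ P_m} χ(a) = Σ_{a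 ∈ P_m} χ'(a) for all m = 0, …, M. (This describes the dual partition of the extension of the partition P_0 | … | P_M of H by the extra block G \ H.) -/
theorem iff_of_ite_eq_ite {R : Type*} [Zero R] {p q : Prop} [Decidable p] [Decidable q]
    {c : R} (hc : c ≠ 0) (h : (if p then c else 0) = if q then c else 0) : p ↔ q := by
  by_cases hp : p <;> by_cases hq : q <;> simp_all

open scoped Classical in
/-- The sum of a character over a subgroup is its order or zero, according to whether the
character is trivial on the subgroup. -/
theorem AddChar.sum_filter_mem_addSubgroup {G : Type*} [AddCommGroup G] [Fintype G]
    (H : AddSubgroup G) [DecidablePred (· ∈ H)] (χ : AddChar G ℂ) :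
    ∑ a ∈ Finset.univ.filter (fun a => a ∈ H), χ a
      = if ∀ a ∈ H, χ a = 1 then (Fintype.card H : ℂ) else 0 := by
  have hsum := AddChar.sum_eq_ite (χ.compAddMonoidHom H.subtype)
  have hiff : χ.compAddMonoidHom H.subtype = 0 ↔ ∀ a ∈ H, χ a = 1 := by
    simp [AddChar.eq_zero_iff]
  simp only [hiff] at hsum
  rw [← hsum, Finset.sum_subtype (p := (· ∈ H)) _ (by simp)]
  rfl

open scoped Classical in
/-- The sum of a character over the whole group is its order or zero, according to whether the
character is trivial. -/
theorem AddChar.sum_eq_ite_forall {G : Type*} [AddCommGroup G] [Fintype G]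
    (χ : AddChar G ℂ) :
    ∑ a, χ a = if ∀ a, χ a = 1 then (Fintype.card G : ℂ) else 0 := by
  simpa only [AddChar.eq_zero_iff] using AddChar.sum_eq_ite χ

/-- Let `G` be a finite abelian group, `H ≤ G`, and `P 0, …, P M` a partition
of `H` into nonempty pairwise disjoint blocks.  For characters `χ, χ'` of `G`, the sums of
`χ` and `χ'` agree on `G \ H` and on every block `P m` iff one of: (i) both are trivial;
(ii) both are nontrivial but trivial on `H`; (iii) both restrict nontrivially to `H` and
their sums agree on every block `P m`. -/
theorem dual_partition_of_subgroup_extension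
    {G : Type*} [AddCommGroup G] [Fintype G] [DecidableEq G]
    (H : AddSubgroup G) [DecidablePred (· ∈ H)]
    (M : ℕ) (P : Fin (M + 1) → Finset G)
    (hne : ∀ m, (P m).Nonempty)
    (hdisj : ∀ m m', m ≠ m' → Disjoint (P m) (P m'))
    (hcover : ∀ a : G, a ∈ H ↔ ∃ m, a ∈ P m)
    (χ χ' : AddChar G ℂ) :
    ((∑ a ∈ Finset.univ.filter (fun a => a ∉ H), χ a
        = ∑ a ∈ Finset.univ.filter (fun a => a ∉ H), χ' a) ∧
      ∀ m, ∑ a ∈ P m, χ a = ∑ a ∈ P m, χ' a)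
    ↔ ((∀ a : G, χ a = 1) ∧ (∀ a : G, χ' a = 1)) ∨
      ((¬ ∀ a : G, χ a = 1) ∧ (¬ ∀ a : G, χ' a = 1) ∧
        (∀ a ∈ H, χ a = 1) ∧ (∀ a ∈ H, χ' a = 1)) ∨
      ((¬ ∀ a ∈ H, χ a = 1) ∧ (¬ ∀ a ∈ H, χ' a = 1) ∧
        ∀ m, ∑ a ∈ P m, χ a = ∑ a ∈ P m, χ' a) := by
  classical
  have hblocks (ψ : AddChar G ℂ) :
      ∑ a ∈ Finset.univ.filter (fun a => a ∈ H), ψ a = ∑ m, ∑ a ∈ P m, ψ a := by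
    rw [← Finset.sum_biUnion fun m _ m' _ h => hdisj m m' h]
    congr 1
    ext a
    simp [hcover]
  have hsplit (ψ : AddChar G ℂ) := Finset.sum_filter_add_sum_filter_not
    Finset.univ (fun a => a ∈ H) (fun a => ψ a)
  have hG : (Fintype.card G : ℂ) ≠ 0 := Nat.cast_ne_zero.2 Fintype.card_ne_zero
  have hH : (Fintype.card H : ℂ) ≠ 0 := Nat.cast_ne_zero.2 Fintype.card_ne_zero
  constructor
  · rintro ⟨hcompl, hP⟩
    have hsumH : ∑ a ∈ Finset.univ.filter (fun a => a ∈ H), χ a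
        = ∑ a ∈ Finset.univ.filter (fun a => a ∈ H), χ' a := by
      simp only [hblocks, hP]
    have hsumG : ∑ a, χ a = ∑ a, χ' a := by rw [← hsplit χ, ← hsplit χ', hsumH, hcompl]
    rw [AddChar.sum_filter_mem_addSubgroup, AddChar.sum_filter_mem_addSubgroup] at hsumH
    rw [AddChar.sum_eq_ite_forall, AddChar.sum_eq_ite_forall] at hsumG
    have hiffG := iff_of_ite_eq_ite hG hsumG
    have hiffH := iff_of_ite_eq_ite hH hsumH
    tauto
  · rintro (⟨h, h'⟩ | ⟨h, h', hr, hr'⟩ | ⟨h, h', hP⟩)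
    · simp [h, h']
    · refine ⟨?_, fun m => Finset.sum_congr rfl fun a ha => ?_⟩
      · have e := hsplit χ
        have e' := hsplit χ'
        rw [AddChar.sum_filter_mem_addSubgroup, AddChar.sum_eq_ite_forall, if_pos hr,
          if_neg h] at e
        rw [AddChar.sum_filter_mem_addSubgroup, AddChar.sum_eq_ite_forall, if_pos hr',
          if_neg h'] at e'
        exact add_left_cancel (e.trans e'.symm)
      · have haH := (hcover a).2 ⟨m, ha⟩
        rw [hr a haH, hr' a haH]
    · refine ⟨?_, hP⟩
      have e := hsplit χ
      have e' := hsplit χ'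
      rw [AddChar.sum_filter_mem_addSubgroup, AddChar.sum_eq_ite_forall, if_neg h,
        if_neg fun k => h fun a _ => k a] at e
      rw [AddChar.sum_filter_mem_addSubgroup, AddChar.sum_eq_ite_forall, if_neg h',
        if_neg fun k => h' fun a _ => k a] at e'
      exact add_left_cancel (e.trans e'.symm)
end

section
/- Let R = ∏_{i=1}^t ∏_{j=1}^{n_i} R_{i,j}, where each R_{i,j} is a finite commutative local Frobenius ring with maximal ideal m_{i,j} and residue field of order q_i, and q_1, …, q_t are distinct prime powers. Set soc(R) := {a : a_{i,j} ∈ soc(R_{i,j}) for all i,j}, rad(R) := {a : a_{i,j} ∈ m_{i,j} for all i,j}, and wt(a_i) := #{j : a_{i,j} ≠ 0}. Let H' be the partition of R with blocks P_⋄ := R \ soc(R) and P_m := {a ∈ soc(R) : wt(a_i) = m_i for all i} for m ∈ M := {0,…,n_1} × ⋯ × {0,…,n_t}. For each i,j let χ_{i,j} be a generating character of R_{i,j}, and let χ(a) := ∏_{i,j} χ_{i,j}(a_{i,j}). Then for a, a' ∈ R the following are equivalent: (1) Σ_{b ∈ B} χ(a·b) = Σ_{b ∈ B} χ(a'·b)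 for every block B of H'; (2) one of the following holds: (i) a = a' = 0; (ii) a, a' ∈ rad(R) \ {0}; (iii) a, a' ∉ rad(R) and, for every i ∈ {1,…,t}, #{j : a_{i,j} ∉ m_{i,j}} = #{j : a'_{i,j} ∉ m_{i,j}}. -/
open scoped Classical

open Polynomial in
theorem Polynomial.coeff_one_prod_one_add_C_mul_X {ι : Type*} (s : Finset ι) (f : ι → ℂ) :
    (∏ j ∈ s, (1 + C (f j) * X)).coeff 1 = ∑ j ∈ s, f j := by
  induction s using Finset.induction_on with
  | empty => simp [coeff_one]
  | insert j s hj ih =>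
    have h0 : (∏ j ∈ s, (1 + C (f j) * X)).coeff 0 = 1 := by
      rw [coeff_zero_prod]
      simp
    rw [Finset.prod_insert hj, Finset.sum_insert hj, mul_coeff_one, ih, h0]
    simp [coeff_one]
    ring

section LocalRing

variable {R : Type*} [CommRing R] [Fintype R]

/-- A twist of a generating character sums to zero over any ideal the twist does not kill. -/
theorem AddChar.sum_mul_ideal_eq_zero (χ : AddChar R ℂ)
    (hχ : ∀ I : Ideal R, (∀ x ∈ I, χ x = 1) → I = ⊥) (I : Ideal R) (a : R)
    (h : ∃ b ∈ I, a * b ≠ 0) : ∑ b with b ∈ I, χ (a * b) = 0 := by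
  obtain ⟨c, hc, hc1⟩ : ∃ c ∈ I, χ (a * c) ≠ 1 := by
    by_contra! hall
    obtain ⟨b, hb, hab⟩ := h
    have hbot := hχ (Ideal.span {a} * I) fun x hx => by
      obtain ⟨z, hz, rfl⟩ := Ideal.mem_span_singleton_mul.1 hx
      exact hall z hz
    have hmem : a * b ∈ Ideal.span {a} * I := Ideal.mem_span_singleton_mul.2 ⟨b, hb, rfl⟩
    rw [hbot] at hmem
    exact hab hmem
  have hshift : ∑ b with b ∈ I, χ (a * b) = ∑ b with b ∈ I, χ (a * (b + c)) :=
    (Finset.sum_equiv (Equiv.addRight c)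
      (fun b => by simp [I.add_mem_iff_left hc]) (fun b _ => rfl)).symm
  simp only [mul_add, AddChar.map_add_eq_mul, ← Finset.sum_mul] at hshift
  have hzero : (∑ b with b ∈ I, χ (a * b)) * (χ (a * c) - 1) = 0 := by linear_combination -hshift
  exact (mul_eq_zero.1 hzero).resolve_right (sub_ne_zero.2 hc1)

variable [DecidableEq R]

theorem AddChar.sum_mul_eq_ite (χ : AddChar R ℂ)
    (hχ : ∀ I : Ideal R, (∀ x ∈ I, χ x = 1) → I = ⊥) (a : R) :
    ∑ b, χ (a * b) = if a = 0 then (Fintype.card R : ℂ) else 0 := by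
  split_ifs with h
  · simp [h]
  · simpa using χ.sum_mul_ideal_eq_zero hχ ⊤ a ⟨1, trivial, by simpa using h⟩

variable [IsLocalRing R]

theorem AddChar.sum_mul_socle_eq_ite {q : ℕ} (hq : q ≠ 1)
    (hsoc : Nat.card {b : R // ∀ x ∈ IsLocalRing.maximalIdeal R, b * x = 0} = q)
    (χ : AddChar R ℂ) (hχ : ∀ I : Ideal R, (∀ x ∈ I, χ x = 1) → I = ⊥) (a : R) :
    ∑ b with (∀ x ∈ IsLocalRing.maximalIdeal R, b * x = 0), χ (a * b)
      = if a ∈ IsLocalRing.maximalIdeal R then (q : ℂ) else 0 := by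
  split_ifs with ha
  · rw [Finset.sum_congr rfl (g := fun _ => (1 : ℂ)), ← hsoc, Nat.card_eq_fintype_card,
      Fintype.card_subtype]
    · simp
    · intro b hb
      rw [mul_comm, (Finset.mem_filter.1 hb).2 a ha, AddChar.map_zero_eq_one]
  · have hunit : IsUnit a := by simpa using ha
    obtain ⟨b, hb, hb0⟩ : ∃ b : R, (∀ x ∈ IsLocalRing.maximalIdeal R, b * x = 0) ∧ b ≠ 0 := by
      by_contra! hall
      refine hq (hsoc.symm.trans (Nat.card_eq_one_iff_unique.2 ⟨⟨fun x y => ?_⟩, ⟨0, by simp⟩⟩))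
      exact Subtype.ext ((hall x x.2).trans (hall y y.2).symm)
    have hann := χ.sum_mul_ideal_eq_zero hχ (IsLocalRing.maximalIdeal R).annihilator a
      ⟨b, Submodule.mem_annihilator.2 hb, by simpa [hunit.mul_right_eq_zero] using hb0⟩
    simpa only [Submodule.mem_annihilator, smul_eq_mul] using hann

end LocalRing

section Product

variable {ι : Type*} [Fintype ι] [DecidableEq ι] {R : ι → Type*} [∀ j, CommRing (R j)] [∀ j, Fintype (R j)]
  [∀ j, DecidableEq (R j)] [∀ j, IsLocalRing (R j)]

open Polynomial in
/-- The character sums over socle elements of weight `k` are the coefficients of a product of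
linear polynomials (a Krawtchouk generating function). -/
theorem sum_socle_weight_eq_coeff {q : ℕ} (hq : q ≠ 1)
    (hsoc : ∀ j, Nat.card {b : R j // ∀ x ∈ IsLocalRing.maximalIdeal (R j), b * x = 0} = q)
    (χ : ∀ j, AddChar (R j) ℂ)
    (hχ : ∀ j, ∀ I : Ideal (R j), (∀ x ∈ I, χ j x = 1) → I = ⊥) (a : ∀ j, R j) (k : ℕ) :
    ∑ b ∈ Finset.univ.filter (fun b : ∀ j, R j =>
        (∀ j, ∀ x ∈ IsLocalRing.maximalIdeal (R j), b j * x = 0) ∧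
          (Finset.univ.filter (fun j => b j ≠ 0)).card = k), ∏ j, χ j (a j * b j)
      = (∏ j, (1 + C (if a j ∈ IsLocalRing.maximalIdeal (R j) then (q : ℂ) - 1 else -1)
          * X)).coeff k := by
  have hfactor (j : ι) :
      1 + C (if a j ∈ IsLocalRing.maximalIdeal (R j) then (q : ℂ) - 1 else -1) * X
        = ∑ r ∈ Finset.univ.filter
            (fun r : R j => ∀ x ∈ IsLocalRing.maximalIdeal (R j), r * x = 0),
            C (χ j (a j * r)) * X ^ (if r ≠ 0 then 1 else 0) := by
    have hmem : (0 : R j) ∈ Finset.univ.filter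
        (fun r : R j => ∀ x ∈ IsLocalRing.maximalIdeal (R j), r * x = 0) := by simp
    have hsum := (χ j).sum_mul_socle_eq_ite hq (hsoc j) (hχ j) (a j)
    rw [← Finset.add_sum_erase _ _ hmem] at hsum ⊢
    have hrest : ∑ r ∈ (Finset.univ.filter
          (fun r : R j => ∀ x ∈ IsLocalRing.maximalIdeal (R j), r * x = 0)).erase 0,
          C (χ j (a j * r)) * X ^ (if r ≠ 0 then 1 else 0)
        = C (∑ r ∈ (Finset.univ.filter
          (fun r : R j => ∀ x ∈ IsLocalRing.maximalIdeal (R j), r * x = 0)).erase 0,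
          χ j (a j * r)) * X := by
      rw [map_sum, Finset.sum_mul]
      refine Finset.sum_congr rfl fun r hr => ?_
      rw [if_pos (Finset.ne_of_mem_erase hr), pow_one]
    rw [hrest]
    simp only [mul_zero, AddChar.map_zero_eq_one] at hsum ⊢
    rw [eq_sub_of_add_eq' hsum]
    split_ifs <;> simp_all
  simp only [hfactor]
  rw [Finset.prod_univ_sum, finsetSum_coeff, ← Finset.filter_filter, Finset.sum_filter]
  refine Finset.sum_congr (by ext; simp) fun b _ => ?_
  rw [Finset.prod_mul_distrib, Finset.prod_pow_eq_pow_sum, ← map_prod, coeff_C_mul_X_pow,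
    Finset.card_filter]
  simp only [eq_comm]

end Product

section DoubleProduct

variable {t : ℕ} {n : Fin t → ℕ} {R : (i : Fin t) → Fin (n i) → Type*}
  [∀ i j, CommRing (R i j)] [∀ i j, Fintype (R i j)]
  [∀ i j, DecidableEq (R i j)]

theorem sum_prod_mul_eq_ite (χ : ∀ i j, AddChar (R i j) ℂ)
    (hχ : ∀ i j, ∀ I : Ideal (R i j), (∀ x ∈ I, χ i j x = 1) → I = ⊥) (a : ∀ i j, R i j) :
    ∑ b : ∀ i j, R i j, ∏ i, ∏ j, χ i j (a i j * b i j)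
      = if a = 0 then (∏ i, ∏ j, Fintype.card (R i j) : ℂ) else 0 := by
  have hprod : ∑ b : ∀ i j, R i j, ∏ i, ∏ j, χ i j (a i j * b i j)
      = ∏ i, ∏ j, ∑ r, χ i j (a i j * r) := by
    simp only [Finset.prod_univ_sum, Fintype.piFinset_univ]
  simp only [hprod, AddChar.sum_mul_eq_ite _ (hχ _ _)]
  split_ifs with h
  · simp [h]
  · obtain ⟨i, hi⟩ := Function.ne_iff.1 h
    obtain ⟨j, hj⟩ := Function.ne_iff.1 hi
    exact Finset.prod_eq_zero (Finset.mem_univ i)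
      (Finset.prod_eq_zero (Finset.mem_univ j) (if_neg hj))

variable [∀ i j, IsLocalRing (R i j)]

theorem sum_socle_prod_mul_eq_ite {q : Fin t → ℕ} (hq : ∀ i, q i ≠ 1)
    (hsoc : ∀ i j,
      Nat.card {b : R i j // ∀ x ∈ IsLocalRing.maximalIdeal (R i j), b * x = 0} = q i)
    (χ : ∀ i j, AddChar (R i j) ℂ)
    (hχ : ∀ i j, ∀ I : Ideal (R i j), (∀ x ∈ I, χ i j x = 1) → I = ⊥) (a : ∀ i j, R i j) :
    ∑ b ∈ Finset.univ.filter (fun b : ∀ i, ∀ j, R i j =>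
        ∀ i j, ∀ x ∈ IsLocalRing.maximalIdeal (R i j), b i j * x = 0),
        ∏ i, ∏ j, χ i j (a i j * b i j)
      = if ∀ i j, a i j ∈ IsLocalRing.maximalIdeal (R i j) then
          (∏ i, ∏ _j : Fin (n i), q i : ℂ) else 0 := by
  have hprod : ∑ b ∈ Finset.univ.filter (fun b : ∀ i, ∀ j, R i j =>
        ∀ i j, ∀ x ∈ IsLocalRing.maximalIdeal (R i j), b i j * x = 0),
        ∏ i, ∏ j, χ i j (a i j * b i j)
      = ∏ i, ∏ j, ∑ r with (∀ x ∈ IsLocalRing.maximalIdeal (R i j), r * x = 0),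
          χ i j (a i j * r) := by
    simp only [Finset.prod_univ_sum]
    refine Finset.sum_congr ?_ fun b _ => rfl
    ext b
    simp [Fintype.mem_piFinset]
  simp only [hprod, AddChar.sum_mul_socle_eq_ite (hq _) (hsoc _ _) _ (hχ _ _)]
  split_ifs with h
  · simp [h]
  · push Not at h
    obtain ⟨i, j, hj⟩ := h
    exact Finset.prod_eq_zero (Finset.mem_univ i)
      (Finset.prod_eq_zero (Finset.mem_univ j) (if_neg hj))

theorem sum_not_socle_prod_mul_eq {q : Fin t → ℕ} (hq : ∀ i, q i ≠ 1)
    (hsoc : ∀ i j,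
      Nat.card {b : R i j // ∀ x ∈ IsLocalRing.maximalIdeal (R i j), b * x = 0} = q i)
    (χ : ∀ i j, AddChar (R i j) ℂ)
    (hχ : ∀ i j, ∀ I : Ideal (R i j), (∀ x ∈ I, χ i j x = 1) → I = ⊥) (a : ∀ i j, R i j) :
    ∑ b ∈ Finset.univ.filter (fun b : ∀ i, ∀ j, R i j =>
        ¬ (∀ i j, ∀ x ∈ IsLocalRing.maximalIdeal (R i j), b i j * x = 0)),
        ∏ i, ∏ j, χ i j (a i j * b i j)
      = (if a = 0 then (∏ i, ∏ j, Fintype.card (R i j) : ℂ) else 0)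
        - if ∀ i j, a i j ∈ IsLocalRing.maximalIdeal (R i j) then
          (∏ i, ∏ _j : Fin (n i), q i : ℂ) else 0 := by
  rw [← sum_prod_mul_eq_ite χ hχ a, ← sum_socle_prod_mul_eq_ite hq hsoc χ hχ a]
  refine eq_sub_of_add_eq' ?_
  exact Finset.sum_filter_add_sum_filter_not _ _ _

open Polynomial in
theorem sum_socle_weights_eq_prod_coeff {q : Fin t → ℕ} (hq : ∀ i, q i ≠ 1)
    (hsoc : ∀ i j,
      Nat.card {b : R i j // ∀ x ∈ IsLocalRing.maximalIdeal (R i j), b * x = 0} = q i)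
    (χ : ∀ i j, AddChar (R i j) ℂ)
    (hχ : ∀ i j, ∀ I : Ideal (R i j), (∀ x ∈ I, χ i j x = 1) → I = ⊥) (a : ∀ i j, R i j)
    (m : Fin t → ℕ) :
    ∑ b ∈ Finset.univ.filter (fun b : ∀ i, ∀ j, R i j =>
        (∀ i j, ∀ x ∈ IsLocalRing.maximalIdeal (R i j), b i j * x = 0) ∧
          ∀ i, (Finset.univ.filter (fun j => b i j ≠ 0)).card = m i),
        ∏ i, ∏ j, χ i j (a i j * b i j)
      = ∏ i, (∏ j, (1 + C (if a i j ∈ IsLocalRing.maximalIdeal (R i j) then (q i : ℂ) - 1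
          else -1) * X)).coeff (m i) := by
  simp only [← sum_socle_weight_eq_coeff (hq _) (hsoc _) (χ _) (hχ _)]
  rw [Finset.prod_univ_sum]
  refine Finset.sum_congr ?_ fun b _ => rfl
  ext b
  simp [Fintype.mem_piFinset, forall_and]

end DoubleProduct

theorem Finset.prod_ite_eq_of_card_filter_not_eq {ι M : Type*} [Fintype ι] [CommMonoid M]
    {p p' : ι → Prop}
    (h : (Finset.univ.filter fun j => ¬ p j).card = (Finset.univ.filter fun j => ¬ p' j).card)
    (x y : M) : (∏ j, if p j then x else y) = ∏ j, if p' j then x else y := by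
  have hp := Finset.card_filter_add_card_filter_not (s := Finset.univ) p
  have hp' := Finset.card_filter_add_card_filter_not (s := Finset.univ) p'
  rw [Finset.prod_ite, Finset.prod_ite]
  simp only [Finset.prod_const]
  rw [h, show (Finset.univ.filter p).card = (Finset.univ.filter p').card by omega]

theorem Finset.sum_ite_sub_one_eq {ι : Type*} [Fintype ι] (p : ι → Prop) (q : ℂ) :
    (∑ j, if p j then q - 1 else -1)
      = (q - 1) * Fintype.card ι - q * (Finset.univ.filter fun j => ¬ p j).card := by
  have hp := congrArg (Nat.cast (R := ℂ))
    (Finset.card_filter_add_card_filter_not (s := Finset.univ) p)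
  push_cast [Finset.card_univ] at hp
  rw [Finset.sum_ite, Finset.sum_const, Finset.sum_const, nsmul_eq_mul, nsmul_eq_mul, ← hp]
  ring

/-- Let `R = ∏_{i,j} R_{i,j}` with `R_{i,j}` finite commutative local Frobenius
rings, residue fields of distinct prime power orders `q i`, and `χ_{i,j}` generating
characters with product character `χ`.  For `a, a' ∈ R`, the sums `Σ_{b ∈ B} χ(a·b)` and
`Σ_{b ∈ B} χ(a'·b)` agree on every block `B` of the partition `H'`
(with blocks `R \ soc(R)` and `P_m = {b ∈ soc(R) : wt(b_i) = m_i}` for `m ∈ M`) iff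
(i) `a = a' = 0`, or (ii) `a, a' ∈ rad(R) \ {0}`, or (iii) `a, a' ∉ rad(R)` and for each `i`
the numbers of unit components of `a_i` and `a'_i` agree. -/
theorem dual_of_hamming_product_partition {t : ℕ} {n : Fin t → ℕ}
    (R : (i : Fin t) → Fin (n i) → Type*)
    [∀ i j, CommRing (R i j)] [∀ i j, Fintype (R i j)] [∀ i j, DecidableEq (R i j)]
    [∀ i j, IsLocalRing (R i j)]
    (q : Fin t → ℕ) (hqpp : ∀ i, IsPrimePow (q i)) (hqdist : Function.Injective q)
    (hq : ∀ i j, Nat.card (R i j ⧸ IsLocalRing.maximalIdeal (R i j)) = q i)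
    (hsoc : ∀ i j,
      Nat.card {b : R i j // ∀ x ∈ IsLocalRing.maximalIdeal (R i j), b * x = 0} = q i)
    (χ : ∀ i j, AddChar (R i j) ℂ)
    (hχgen : ∀ i j, ∀ I : Ideal (R i j), (∀ x ∈ I, χ i j x = 1) → I = ⊥)
    (a a' : ∀ i, ∀ j, R i j) :
    ((∑ b ∈ Finset.univ.filter
          (fun b : ∀ i, ∀ j, R i j =>
            ¬ (∀ i j, ∀ x ∈ IsLocalRing.maximalIdeal (R i j), b i j * x = 0)),
          ∏ i, ∏ j, χ i j (a i j * b i j)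
        = ∑ b ∈ Finset.univ.filter
          (fun b : ∀ i, ∀ j, R i j =>
            ¬ (∀ i j, ∀ x ∈ IsLocalRing.maximalIdeal (R i j), b i j * x = 0)),
          ∏ i, ∏ j, χ i j (a' i j * b i j)) ∧
      ∀ m : Fin t → ℕ, (∀ i, m i ≤ n i) →
        ∑ b ∈ Finset.univ.filter
          (fun b : ∀ i, ∀ j, R i j =>
            (∀ i j, ∀ x ∈ IsLocalRing.maximalIdeal (R i j), b i j * x = 0) ∧
            ∀ i, (Finset.univ.filter (fun j => b i j ≠ 0)).card = m i),
          ∏ i, ∏ j, χ i j (a i j * b i j)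
        = ∑ b ∈ Finset.univ.filter
          (fun b : ∀ i, ∀ j, R i j =>
            (∀ i j, ∀ x ∈ IsLocalRing.maximalIdeal (R i j), b i j * x = 0) ∧
            ∀ i, (Finset.univ.filter (fun j => b i j ≠ 0)).card = m i),
          ∏ i, ∏ j, χ i j (a' i j * b i j))
    ↔ (a = 0 ∧ a' = 0) ∨
      (a ≠ 0 ∧ a' ≠ 0 ∧ (∀ i j, a i j ∈ IsLocalRing.maximalIdeal (R i j)) ∧
        (∀ i j, a' i j ∈ IsLocalRing.maximalIdeal (R i j))) ∨
      ((¬ ∀ i j, a i j ∈ IsLocalRing.maximalIdeal (R i j)) ∧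
        (¬ ∀ i j, a' i j ∈ IsLocalRing.maximalIdeal (R i j)) ∧
        ∀ i, (Finset.univ.filter
            (fun j => a i j ∉ IsLocalRing.maximalIdeal (R i j))).card
          = (Finset.univ.filter
            (fun j => a' i j ∉ IsLocalRing.maximalIdeal (R i j))).card) := by
  have hq1 (i : Fin t) : q i ≠ 1 := (hqpp i).ne_one
  have hcard : (∏ i, ∏ j, Fintype.card (R i j) : ℂ) ≠ 0 :=
    Finset.prod_ne_zero_iff.2 fun i _ => Finset.prod_ne_zero_iff.2 fun j _ =>
      Nat.cast_ne_zero.2 Fintype.card_ne_zero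
  simp only [sum_not_socle_prod_mul_eq hq1 hsoc χ hχgen,
    sum_socle_weights_eq_prod_coeff hq1 hsoc χ hχgen]
  constructor
  · rintro ⟨hnot, hweight⟩
    have hunits (i : Fin t) : (Finset.univ.filter
          (fun j => a i j ∉ IsLocalRing.maximalIdeal (R i j))).card
        = (Finset.univ.filter
          (fun j => a' i j ∉ IsLocalRing.maximalIdeal (R i j))).card := by
      rcases Nat.eq_zero_or_pos (n i) with hn | hn
      · have : IsEmpty (Fin (n i)) := by rw [hn]; infer_instance
        simp
      have hi := hweight (Pi.single i 1) fun k => by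
        rcases eq_or_ne k i with rfl | hk
        · simpa using Nat.succ_le_of_lt hn
        · simp [hk]
      rw [Fintype.prod_eq_single i, Fintype.prod_eq_single i, Pi.single_eq_same,
        Polynomial.coeff_one_prod_one_add_C_mul_X, Polynomial.coeff_one_prod_one_add_C_mul_X,
        Finset.sum_ite_sub_one_eq, Finset.sum_ite_sub_one_eq] at hi
      · have hq0 : (q i : ℂ) ≠ 0 := Nat.cast_ne_zero.2 (hqpp i).ne_zero
        exact Nat.cast_injective (mul_left_cancel₀ hq0 (sub_right_injective hi))
      all_goals
        intro k hk
        rw [Pi.single_eq_of_ne hk, Polynomial.coeff_zero_prod]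
        simp
    have hrad : (∀ i j, a i j ∈ IsLocalRing.maximalIdeal (R i j)) ↔
        ∀ i j, a' i j ∈ IsLocalRing.maximalIdeal (R i j) := by
      refine forall_congr' fun i => ?_
      have h := congrArg (· = 0) (hunits i)
      simpa [Finset.filter_eq_empty_iff] using h
    by_cases ha : ∀ i j, a i j ∈ IsLocalRing.maximalIdeal (R i j)
    · have ha' := hrad.1 ha
      rw [if_pos ha, if_pos ha', sub_left_inj] at hnot
      by_cases h0 : a = 0 <;> by_cases h0' : a' = 0
      · exact Or.inl ⟨h0, h0'⟩
      · rw [if_pos h0, if_neg h0'] at hnot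
        exact absurd hnot hcard
      · rw [if_neg h0, if_pos h0'] at hnot
        exact absurd hnot.symm hcard
      · exact Or.inr (Or.inl ⟨h0, h0', ha, ha'⟩)
    · exact Or.inr (Or.inr ⟨ha, fun h => ha (hrad.2 h), hunits⟩)
  · rintro (⟨rfl, rfl⟩ | ⟨h0, h0', ha, ha'⟩ | ⟨ha, ha', hunits⟩)
    · exact ⟨rfl, fun _ _ => rfl⟩
    · simp [h0, h0', ha, ha']
    · have hne {c : ∀ i, ∀ j, R i j}
          (hc : ¬ ∀ i j, c i j ∈ IsLocalRing.maximalIdeal (R i j)) : c ≠ 0 := by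
        rintro rfl
        exact hc fun i j => zero_mem _
      refine ⟨by rw [if_neg (hne ha), if_neg (hne ha'), if_neg ha, if_neg ha'], fun m _ => ?_⟩
      refine Finset.prod_congr rfl fun i _ => congrArg (Polynomial.coeff · (m i)) ?_
      simp only [apply_ite (fun z : ℂ => 1 + Polynomial.C z * Polynomial.X)]
      exact Finset.prod_ite_eq_of_card_filter_not_eq (hunits i) _ _
end

section
/- Let R = ∏_{i=1}^t ∏_{j=1}^{n_i} R_{i,j}, where each R_{i,j} is a finite commutative local Frobenius ring with maximal ideal m_{i,j} and residue field of order q_i, and q_1, …, q_t are distinct prime powers. Set soc(R) := {a : a_{i,j} ∈ soc(R_{i,j}) for all i,j}, rad(R) := {a : a_{i,j} ∈ m_{i,j} for all i,j}, wt(a_i) := #{j : a_{i,j} ≠ 0}, and P_m := {a ∈ soc(R) : wt(a_i) = m_i for all i} for m ∈ M := {0,…,n_1} × ⋯ × {0,…,n_t}. Let χ_{i,j} be a generating character of R_{i,j} for each i,j and χ(a) := ∏_{i,j} χ_{i,j}(a_{i,j}). Define the Krawtchouk polynomial K_m^{(n,q)}(ℓ) := Σ_{j=0}^m (−1)^j (q−1)^{m−j}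 C(ℓ,j) C(n−ℓ, m−j). Let a ∈ R and set ℓ_i := #{j : a_{i,j} ∉ m_{i,j}}. Then: (1) if a ∉ rad(R), then Σ_{b ∈ P_m} χ(a·b) = ∏_{i=1}^t K_{m_i}^{(n_i,q_i)}(ℓ_i) for every m ∈ M, and Σ_{b ∈ R\soc(R)} χ(a·b) = 0; (2) if a ∈ rad(R) \ {0}, then Σ_{b ∈ P_m} χ(a·b) = ∏_{i=1}^t C(n_i,m_i)(q_i−1)^{m_i} for every m ∈ M, and Σ_{b ∈ R\soc(R)} χ(a·b) = −∏_{i=1}^t q_i^{n_i}. -/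
open scoped Classical

/-- The Krawtchouk polynomial value
`K_m^{(n,q)}(ℓ) = Σ_{j=0}^m (−1)^j (q−1)^{m−j} C(ℓ,j) C(n−ℓ,m−j)`. -/
def krawtchouk (n q m ℓ : ℕ) : ℤ :=
  ∑ j ∈ Finset.range (m + 1),
    (-1) ^ j * ((q : ℤ) - 1) ^ (m - j) * (ℓ.choose j) * ((n - ℓ).choose (m - j))

open Finset Polynomial IsLocalRing in
/-- The generating function of the Krawtchouk values. -/
lemma coeff_one_sub_X_pow_mul (n q m ℓ : ℕ) :
    (((1 - X : ℂ[X]) ^ ℓ) * (1 + C ((q : ℂ) - 1) * X) ^ (n - ℓ)).coeff m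
      = (krawtchouk n q m ℓ : ℂ) := by
  have h (c : ℂ) (N k : ℕ) : ((1 + C c * X : ℂ[X]) ^ N).coeff k = c ^ k * N.choose k := by
    have hcomp : (1 + C c * X : ℂ[X]) ^ N = ((1 + X) ^ N : ℂ[X]).comp (C c * X) := by simp
    rw [hcomp, comp_C_mul_X_coeff, coeff_one_add_X_pow, mul_comm]
  have hneg : (1 - X : ℂ[X]) = 1 + C (-1) * X := by simp [sub_eq_add_neg]
  rw [hneg, coeff_mul, Finset.Nat.sum_antidiagonal_eq_sum_range_succ_mk, krawtchouk]
  push_cast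
  refine sum_congr rfl fun j _ => ?_
  rw [h, h]
  ring

lemma krawtchouk_zero_right (n q m : ℕ) :
    krawtchouk n q m 0 = n.choose m * ((q : ℤ) - 1) ^ m := by
  rw [krawtchouk, Finset.sum_eq_single 0]
  · simp [mul_comm]
  · intro j _ hj
    simp [Nat.choose_eq_zero_of_lt (Nat.pos_of_ne_zero hj)]
  · simp

lemma AddChar.sum_ideal_mul_eq_zero {R : Type*} [CommRing R] [Fintype R] (χ : AddChar R ℂ)
    (I : Ideal R) {a y : R} (hy : y ∈ I) (h : χ (a * y) ≠ 1) :
    ∑ b with b ∈ I, χ (a * b) = 0 := by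
  have hshift : ∑ b with b ∈ I, χ (a * b) = χ (a * y) * ∑ b with b ∈ I, χ (a * b) := by
    rw [Finset.mul_sum]
    refine (Finset.sum_equiv (Equiv.addLeft y) ?_ ?_).symm
    · intro b
      simp [I.add_mem_iff_right hy]
    · intro b _
      simp [mul_add, AddChar.map_add_eq_mul]
  have hmul : (χ (a * y) - 1) * ∑ b with b ∈ I, χ (a * b) = 0 := by
    rw [sub_mul, ← hshift, one_mul, sub_self]
  exact (mul_eq_zero.mp hmul).resolve_left (sub_ne_zero.mpr h)

lemma AddChar.sum_mul_eq_zero_of_generating {R : Type*} [CommRing R] [Fintype R]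
    (χ : AddChar R ℂ) (hχ : ∀ I : Ideal R, (∀ x ∈ I, χ x = 1) → I = ⊥) {a : R} (ha : a ≠ 0) :
    ∑ b, χ (a * b) = 0 := by
  obtain ⟨y, hy⟩ : ∃ y, χ (a * y) ≠ 1 := by
    by_contra! h
    refine ha (Ideal.span_singleton_eq_bot.mp (hχ _ fun x hx => ?_))
    obtain ⟨y, rfl⟩ := Ideal.mem_span_singleton'.mp hx
    rw [mul_comm, h]
  simpa using χ.sum_ideal_mul_eq_zero ⊤ Submodule.mem_top hy

section Local

open Finset Polynomial IsLocalRing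

variable {R : Type*} [CommRing R] [Fintype R] [DecidableEq R] [IsLocalRing R]

lemma sum_socle_of_mem (χ : AddChar R ℂ) {a : R} (ha : a ∈ maximalIdeal R) :
    ∑ b with ∀ x ∈ maximalIdeal R, b * x = 0, χ (a * b)
      = Nat.card {b : R // ∀ x ∈ maximalIdeal R, b * x = 0} := by
  rw [Nat.card_eq_fintype_card, Fintype.card_subtype, cast_card]
  refine sum_congr rfl fun b hb => ?_
  rw [mul_comm, (mem_filter.mp hb).2 a ha, AddChar.map_zero_eq_one]

lemma sum_socle_of_notMem (χ : AddChar R ℂ)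
    (hχ : ∀ I : Ideal R, (∀ x ∈ I, χ x = 1) → I = ⊥)
    (hcard : 1 < Nat.card {b : R // ∀ x ∈ maximalIdeal R, b * x = 0})
    {a : R} (ha : a ∉ maximalIdeal R) :
    ∑ b with ∀ x ∈ maximalIdeal R, b * x = 0, χ (a * b) = 0 := by
  have hmem (b : R) : b ∈ (maximalIdeal R).annihilator ↔ ∀ x ∈ maximalIdeal R, b * x = 0 := by
    simp [Submodule.mem_annihilator]
  have hne : (maximalIdeal R).annihilator ≠ ⊥ := by
    intro hbot
    have : Subsingleton {b : R // ∀ x ∈ maximalIdeal R, b * x = 0} := by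
      refine ⟨fun b c => Subtype.ext ?_⟩
      have hb := (hmem b).mpr b.2
      have hc := (hmem c).mpr c.2
      rw [hbot, Submodule.mem_bot] at hb hc
      rw [hb, hc]
    exact hcard.not_ge (Finite.card_le_one_iff_subsingleton.mpr this)
  obtain ⟨x, hx, hχx⟩ : ∃ x ∈ (maximalIdeal R).annihilator, χ x ≠ 1 := by
    by_contra! h
    exact hne (hχ _ h)
  obtain ⟨u, rfl⟩ := notMem_maximalIdeal.mp ha
  have h := χ.sum_ideal_mul_eq_zero (maximalIdeal R).annihilator (a := u) (y := ↑u⁻¹ * x)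
    (Ideal.mul_mem_left _ _ hx) (by simpa using hχx)
  simpa only [hmem] using h

/-- The weight-graded character sum over the socle. -/
lemma sum_socle_C_mul_X_pow (χ : AddChar R ℂ) (q : ℕ) (hq : 1 < q)
    (hχ : ∀ I : Ideal R, (∀ x ∈ I, χ x = 1) → I = ⊥)
    (hcard : Nat.card {b : R // ∀ x ∈ maximalIdeal R, b * x = 0} = q) (a : R) :
    ∑ b with ∀ x ∈ maximalIdeal R, b * x = 0,
        C (χ (a * b)) * X ^ (if b ≠ 0 then 1 else 0)
      = if a ∉ maximalIdeal R then 1 - X else 1 + C ((q : ℂ) - 1) * X := by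
  have h0 : (0 : R) ∈ univ.filter fun b : R => ∀ x ∈ maximalIdeal R, b * x = 0 := by simp
  have key : ∑ b with ∀ x ∈ maximalIdeal R, b * x = 0,
        C (χ (a * b)) * X ^ (if b ≠ 0 then 1 else 0)
      = 1 + C (∑ b with ∀ x ∈ maximalIdeal R, b * x = 0, χ (a * b) - 1) * X := by
    rw [← add_sum_erase _ _ h0, ← add_sum_erase _ (fun b => χ (a * b)) h0]
    simp only [mul_zero, AddChar.map_zero_eq_one, add_sub_cancel_left, map_sum, sum_mul]
    congr 1
    · simp
    · refine sum_congr rfl fun b hb => ?_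
      simp [(mem_erase.mp hb).1]
  rw [key]
  split_ifs with ha
  · rw [sum_socle_of_mem χ ha, hcard]
  · rw [sum_socle_of_notMem χ hχ (hcard ▸ hq) ha]
    simp [sub_eq_add_neg]

end Local

open Finset Polynomial IsLocalRing in
/-- The character sum over the vectors of weight `m` with all components in the socles. -/
lemma sum_socle_weight_eq_krawtchouk {n : ℕ} (R : Fin n → Type*)
    [∀ j, CommRing (R j)] [∀ j, Fintype (R j)] [∀ j, DecidableEq (R j)]
    [∀ j, IsLocalRing (R j)] (q : ℕ) (hq : 1 < q)
    (hsoc : ∀ j, Nat.card {b : R j // ∀ x ∈ maximalIdeal (R j), b * x = 0} = q)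
    (χ : ∀ j, AddChar (R j) ℂ)
    (hχ : ∀ j, ∀ I : Ideal (R j), (∀ x ∈ I, χ j x = 1) → I = ⊥)
    (a : ∀ j, R j) (m : ℕ) :
    ∑ b : ∀ j, R j with (∀ j, ∀ x ∈ maximalIdeal (R j), b j * x = 0) ∧
        (univ.filter fun j => b j ≠ 0).card = m, ∏ j, χ j (a j * b j)
      = (krawtchouk n q m (univ.filter fun j => a j ∉ maximalIdeal (R j)).card : ℂ) := by
  set S : ∀ j, Finset (R j) := fun j => univ.filter fun b => ∀ x ∈ maximalIdeal (R j), b * x = 0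
    with hS
  have hcompl : (univ.filter fun j => ¬ a j ∉ maximalIdeal (R j)).card
      = n - (univ.filter fun j => a j ∉ maximalIdeal (R j)).card := by
    have := card_filter_add_card_filter_not (s := (univ : Finset (Fin n)))
      (fun j => a j ∉ maximalIdeal (R j))
    rw [card_univ, Fintype.card_fin] at this
    omega
  have hprod := congrArg (fun p : ℂ[X] => p.coeff m)
    (prod_congr (rfl : (univ : Finset (Fin n)) = univ) fun j _ =>
      sum_socle_C_mul_X_pow (χ j) q hq (hχ j) (hsoc j) (a j))
  simp only [prod_ite, prod_const, hcompl, coeff_one_sub_X_pow_mul] at hprod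
  rw [← hprod, prod_univ_sum, finsetSum_coeff]
  have hterm (b : ∀ j, R j) :
      (∏ j, (C (χ j (a j * b j)) * X ^ (if b j ≠ 0 then 1 else 0)) : ℂ[X]).coeff m
        = if (univ.filter fun j => b j ≠ 0).card = m then ∏ j, χ j (a j * b j) else 0 := by
    rw [prod_mul_distrib, ← map_prod, prod_pow_eq_pow_sum, coeff_C_mul_X_pow, card_filter]
    simp only [eq_comm]
  simp only [hterm]
  rw [← sum_filter]
  refine sum_congr ?_ fun _ _ => rfl
  ext b
  simp [Fintype.mem_piFinset]

open Finset in
lemma sum_filter_forall_prod {ι : Type*} [Fintype ι] [DecidableEq ι] {A : ι → Type*}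
    [∀ i, Fintype (A i)] {M : Type*} [CommSemiring M] (P : ∀ i, A i → Prop)
    [DecidablePred fun b : ∀ i, A i => ∀ i, P i (b i)] [∀ i, DecidablePred (P i)]
    (f : ∀ i, A i → M) :
    ∑ b ∈ univ.filter (fun b : ∀ i, A i => ∀ i, P i (b i)), ∏ i, f i (b i)
      = ∏ i, ∑ c ∈ univ.filter (P i), f i c := by
  rw [prod_univ_sum]
  refine sum_congr ?_ fun _ _ => rfl
  ext b
  simp [Fintype.mem_piFinset]

/-- Krawtchouk coefficients of the pair `(H', Ĥ')` for
`R = ∏_{i,j} R_{i,j}` a product of finite commutative local Frobenius rings with residue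
fields of distinct prime power orders `q i`, and `χ` the product of generating characters:
with `ℓ i` the number of unit components of `a_i`,
(1) if `a ∉ rad(R)` then `Σ_{b ∈ P_m} χ(a·b) = ∏ i K_{m_i}^{(n_i,q_i)}(ℓ_i)` for `m ∈ M`,
and `Σ_{b ∉ soc(R)} χ(a·b) = 0`;
(2) if `a ∈ rad(R) \ {0}` then `Σ_{b ∈ P_m} χ(a·b) = ∏ i C(n_i,m_i)(q_i−1)^{m_i}` and
`Σ_{b ∉ soc(R)} χ(a·b) = −∏ i q_i^{n_i}`. -/
theorem krawtchouk_coefficients {t : ℕ} {n : Fin t → ℕ}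
    (R : (i : Fin t) → Fin (n i) → Type*)
    [∀ i j, CommRing (R i j)] [∀ i j, Fintype (R i j)] [∀ i j, DecidableEq (R i j)]
    [∀ i j, IsLocalRing (R i j)]
    (q : Fin t → ℕ) (hqpp : ∀ i, IsPrimePow (q i)) (hqdist : Function.Injective q)
    (hq : ∀ i j, Nat.card (R i j ⧸ IsLocalRing.maximalIdeal (R i j)) = q i)
    (hsoc : ∀ i j,
      Nat.card {b : R i j // ∀ x ∈ IsLocalRing.maximalIdeal (R i j), b * x = 0} = q i)
    (χ : ∀ i j, AddChar (R i j) ℂ)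
    (hχgen : ∀ i j, ∀ I : Ideal (R i j), (∀ x ∈ I, χ i j x = 1) → I = ⊥)
    (a : ∀ i, ∀ j, R i j)
    (ℓ : Fin t → ℕ)
    (hℓ : ∀ i, ℓ i = (Finset.univ.filter
      (fun j => a i j ∉ IsLocalRing.maximalIdeal (R i j))).card) :
    ((¬ ∀ i j, a i j ∈ IsLocalRing.maximalIdeal (R i j)) →
      (∀ m : Fin t → ℕ, (∀ i, m i ≤ n i) →
        ∑ b ∈ Finset.univ.filter
          (fun b : ∀ i, ∀ j, R i j =>
            (∀ i j, ∀ x ∈ IsLocalRing.maximalIdeal (R i j), b i j * x = 0) ∧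
            ∀ i, (Finset.univ.filter (fun j => b i j ≠ 0)).card = m i),
          ∏ i, ∏ j, χ i j (a i j * b i j)
        = ∏ i, (krawtchouk (n i) (q i) (m i) (ℓ i) : ℂ)) ∧
      ∑ b ∈ Finset.univ.filter
        (fun b : ∀ i, ∀ j, R i j =>
          ¬ (∀ i j, ∀ x ∈ IsLocalRing.maximalIdeal (R i j), b i j * x = 0)),
        ∏ i, ∏ j, χ i j (a i j * b i j) = 0) ∧
    ((∀ i j, a i j ∈ IsLocalRing.maximalIdeal (R i j)) → a ≠ 0 →
      (∀ m : Fin t → ℕ, (∀ i, m i ≤ n i) →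
        ∑ b ∈ Finset.univ.filter
          (fun b : ∀ i, ∀ j, R i j =>
            (∀ i j, ∀ x ∈ IsLocalRing.maximalIdeal (R i j), b i j * x = 0) ∧
            ∀ i, (Finset.univ.filter (fun j => b i j ≠ 0)).card = m i),
          ∏ i, ∏ j, χ i j (a i j * b i j)
        = ∏ i, (((n i).choose (m i) : ℂ) * ((q i : ℂ) - 1) ^ (m i))) ∧
      ∑ b ∈ Finset.univ.filter
        (fun b : ∀ i, ∀ j, R i j =>
          ¬ (∀ i j, ∀ x ∈ IsLocalRing.maximalIdeal (R i j), b i j * x = 0)),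
        ∏ i, ∏ j, χ i j (a i j * b i j) = -∏ i, (q i : ℂ) ^ (n i)) := by
  have hq1 (i) : 1 < q i := (hqpp i).one_lt
  have hweight (m : Fin t → ℕ) :
      ∑ b ∈ Finset.univ.filter
          (fun b : ∀ i, ∀ j, R i j =>
            (∀ i j, ∀ x ∈ IsLocalRing.maximalIdeal (R i j), b i j * x = 0) ∧
            ∀ i, (Finset.univ.filter (fun j => b i j ≠ 0)).card = m i),
          ∏ i, ∏ j, χ i j (a i j * b i j)
        = ∏ i, (krawtchouk (n i) (q i) (m i) (ℓ i) : ℂ) := by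
    simp only [← forall_and]
    rw [sum_filter_forall_prod
      (fun i (c : ∀ j, R i j) => (∀ j, ∀ x ∈ IsLocalRing.maximalIdeal (R i j), c j * x = 0) ∧
        (Finset.univ.filter (fun j => c j ≠ 0)).card = m i)
      (fun i c => ∏ j, χ i j (a i j * c j))]
    refine Finset.prod_congr rfl fun i _ => ?_
    rw [hℓ i]
    convert sum_socle_weight_eq_krawtchouk (R i) (q i) (hq1 i) (hsoc i) (χ i) (hχgen i) (a i) (m i)
  have htotal (ha : a ≠ 0) : ∑ b : ∀ i, ∀ j, R i j, ∏ i, ∏ j, χ i j (a i j * b i j) = 0 := by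
    obtain ⟨i, hi⟩ := Function.ne_iff.mp ha
    obtain ⟨j, hj⟩ := Function.ne_iff.mp hi
    have h := Fintype.prod_sum (fun i (c : ∀ j, R i j) => ∏ j, χ i j (a i j * c j))
    rw [← h]
    refine Finset.prod_eq_zero (Finset.mem_univ i) ?_
    rw [← Fintype.prod_sum (fun j (c : R i j) => χ i j (a i j * c))]
    exact Finset.prod_eq_zero (Finset.mem_univ j)
      ((χ i j).sum_mul_eq_zero_of_generating (hχgen i j) hj)
  have hsocle : ∑ b ∈ Finset.univ.filter
        (fun b : ∀ i, ∀ j, R i j =>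
          ∀ i j, ∀ x ∈ IsLocalRing.maximalIdeal (R i j), b i j * x = 0),
        ∏ i, ∏ j, χ i j (a i j * b i j)
      = ∏ i, ∏ j, ∑ c with ∀ x ∈ IsLocalRing.maximalIdeal (R i j), c * x = 0,
          χ i j (a i j * c) := by
    rw [sum_filter_forall_prod
      (fun i (c : ∀ j, R i j) => ∀ j, ∀ x ∈ IsLocalRing.maximalIdeal (R i j), c j * x = 0)
      (fun i c => ∏ j, χ i j (a i j * c j))]
    refine Finset.prod_congr rfl fun i _ => ?_
    exact sum_filter_forall_prod
      (fun j (c : R i j) => ∀ x ∈ IsLocalRing.maximalIdeal (R i j), c * x = 0)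
      (fun j c => χ i j (a i j * c))
  have hcompl := Finset.sum_filter_add_sum_filter_not Finset.univ
    (fun b : ∀ i, ∀ j, R i j => ∀ i j, ∀ x ∈ IsLocalRing.maximalIdeal (R i j), b i j * x = 0)
    (fun b => ∏ i, ∏ j, χ i j (a i j * b i j))
  rw [hsocle] at hcompl
  constructor
  · intro ha
    refine ⟨fun m _ => hweight m, ?_⟩
    have ha0 : a ≠ 0 := by
      rintro rfl
      exact ha fun i j => by simp
    push Not at ha
    obtain ⟨i, j, hij⟩ := ha
    rw [htotal ha0, Finset.prod_eq_zero (Finset.mem_univ i), zero_add] at hcompl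
    · exact hcompl
    · exact Finset.prod_eq_zero (Finset.mem_univ j)
        (sum_socle_of_notMem (χ i j) (hχgen i j) (hsoc i j ▸ hq1 i) hij)
  · intro ha ha0
    constructor
    · intro m _
      rw [hweight m]
      refine Finset.prod_congr rfl fun i _ => ?_
      have hℓ0 : ℓ i = 0 := by simp [hℓ i, ha i]
      rw [hℓ0, krawtchouk_zero_right]
      push_cast
      rfl
    · rw [htotal ha0] at hcompl
      simp only [fun i j => sum_socle_of_mem (χ i j) (ha i j), hsoc, Finset.prod_const,
        Finset.card_univ, Fintype.card_fin] at hcompl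
      exact eq_neg_of_add_eq_zero_right hcompl
end

section
/- Let q_1, …, q_t be distinct prime powers such that the list [(q_1,n_1), …, (q_t,n_t)] is separating, let F_i be a finite field with q_i elements, and let R = F_1^{n_1} × ⋯ × F_t^{n_t} (a semisimple commutative ring). Write a ∈ R as (a_1,…,a_t) with a_i ∈ F_i^{n_i}, let wt(a_i) := #{j : a_{i,j} ≠ 0}, and define ω(a) := 1 − ∏_{i=1}^t (−1/(q_i−1))^{wt(a_i)} (the normalized homogeneous weight on R). Let χ_i be a nontrivial additive character of F_i for each i, and define the generating character χ of R by χ(a) := ∏_{i=1}^t ∏_{j=1}^{n_i} χ_i(a_{i,j}). Then for all a, b ∈ R: ω(a) = ω(b) if and only if for every c ∈ ℝ, Σ_{x ∈ R, ω(x) = c} χ(a·x) = Σ_{x ∈ R, ω(x) = c} χ(b·x). (The homogeneous weight partition of R is self-dual.) -/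
open scoped Classical

/-- The list `[(q 1, n 1), …, (q t, n t)]` is separating. -/
def SeparatingList {t : ℕ} (q n : Fin t → ℕ) : Prop :=
  ∀ m ℓ : Fin t → ℕ, (∀ i, m i ≤ n i) → (∀ i, ℓ i ≤ n i) → m ≠ ℓ →
    (∏ i, (q i - 1) ^ m i ≠ ∏ i, (q i - 1) ^ ℓ i) ∨ (∑ i, m i) % 2 ≠ (∑ i, ℓ i) % 2

/-- A product of powers of the numbers `-1 / (q i - 1)` determines the exponents when the list is
separating. -/
theorem SeparatingList.eq_of_prod_eq {t : ℕ} {q n : Fin t → ℕ} (hsep : SeparatingList q n)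
    (hq : ∀ i, 2 ≤ q i) {m ℓ : Fin t → ℕ} (hm : ∀ i, m i ≤ n i) (hℓ : ∀ i, ℓ i ≤ n i)
    (h : ∏ i, (-1 / ((q i : ℝ) - 1)) ^ m i = ∏ i, (-1 / ((q i : ℝ) - 1)) ^ ℓ i) : m = ℓ := by
  have hprod : ∀ k : Fin t → ℕ, ∏ i, (-1 / ((q i : ℝ) - 1)) ^ k i
      = (-1) ^ (∑ i, k i) / ((∏ i, (q i - 1) ^ k i : ℕ) : ℝ) := by
    intro k
    rw [← Finset.prod_pow_eq_pow_sum, Nat.cast_prod, ← Finset.prod_div_distrib]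
    refine Finset.prod_congr rfl fun i _ => ?_
    rw [div_pow, Nat.cast_pow, Nat.cast_sub (by have := hq i; omega), Nat.cast_one]
  have hpos : ∀ k : Fin t → ℕ, (0 : ℝ) < ((∏ i, (q i - 1) ^ k i : ℕ) : ℝ) := fun k =>
    Nat.cast_pos.2 (Finset.prod_pos fun i _ => pow_pos (by have := hq i; omega) _)
  rw [hprod, hprod] at h
  by_contra hne
  have habs := congrArg abs h
  rw [abs_div, abs_div, abs_neg_one_pow, abs_neg_one_pow, abs_of_pos (hpos m),
    abs_of_pos (hpos ℓ), div_eq_div_iff (hpos m).ne' (hpos ℓ).ne', one_mul, one_mul,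
    Nat.cast_inj] at habs
  rcases hsep m ℓ hm hℓ hne with h1 | h1
  · exact h1 habs.symm
  · rw [habs, div_left_inj' (hpos m).ne'] at h
    rcases Nat.even_or_odd (∑ i, m i) with h2 | h2 <;>
    rcases Nat.even_or_odd (∑ i, ℓ i) with h3 | h3
    · exact h1 (by rw [Nat.even_iff.1 h2, Nat.even_iff.1 h3])
    · rw [h2.neg_one_pow, h3.neg_one_pow] at h
      norm_num at h
    · rw [h2.neg_one_pow, h3.neg_one_pow] at h
      norm_num at h
    · exact h1 (by rw [Nat.odd_iff.1 h2, Nat.odd_iff.1 h3])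

/-- Two vectors over a field with the same Hamming weight differ by a monomial transformation. -/
theorem exists_perm_units_of_hammingNorm_eq {ι K : Type*} [Fintype ι] [Field K] [DecidableEq K]
    {a b : ι → K} (h : hammingNorm a = hammingNorm b) :
    ∃ (σ : Equiv.Perm ι) (u : ι → Kˣ), ∀ j, b (σ j) = a j * u j := by
  have hc : Fintype.card {j // a j ≠ 0} = Fintype.card {j // b j ≠ 0} := by
    simpa [Fintype.card_subtype, hammingNorm] using h
  let e := Fintype.equivOfCardEq hc
  have hσ : ∀ j, b (e.extendSubtype j) ≠ 0 ↔ a j ≠ 0 := fun j =>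
    ⟨fun hb => by_contra fun ha => e.extendSubtype_not_mem j ha hb, e.extendSubtype_mem j⟩
  refine ⟨e.extendSubtype,
    fun j => if ha : a j ≠ 0 then Units.mk0 (b (e.extendSubtype j) / a j)
      (div_ne_zero ((hσ j).2 ha) ha) else 1, fun j => ?_⟩
  by_cases ha : a j = 0
  · have hb : b (e.extendSubtype j) = 0 := by simpa [ha] using hσ j
    simp [ha, hb]
  · simp [ha, mul_div_cancel₀]

/-- The coordinatewise monomial transformation given by permutations and units. -/
def monomialEquiv {ι : Type*} {κ : ι → Type*} {F : ι → Type*} [∀ i, Field (F i)]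
    (σ : ∀ i, Equiv.Perm (κ i)) (u : ∀ i, κ i → (F i)ˣ) :
    (∀ i, κ i → F i) ≃ (∀ i, κ i → F i) :=
  Equiv.piCongrRight fun i =>
    ((σ i).arrowCongr (Equiv.refl (F i))).symm.trans
      (Equiv.piCongrRight fun j => (u i j).mulLeft)

theorem monomialEquiv_apply {ι : Type*} {κ : ι → Type*} {F : ι → Type*} [∀ i, Field (F i)]
    (σ : ∀ i, Equiv.Perm (κ i)) (u : ∀ i, κ i → (F i)ˣ) (x : ∀ i, κ i → F i) (i : ι) (j : κ i) :
    monomialEquiv σ u x i j = u i j * x i (σ i j) := rfl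

theorem hammingNorm_monomialEquiv {ι : Type*} {κ : ι → Type*} [∀ i, Fintype (κ i)]
    {F : ι → Type*} [∀ i, Field (F i)] [∀ i, DecidableEq (F i)]
    (σ : ∀ i, Equiv.Perm (κ i)) (u : ∀ i, κ i → (F i)ˣ) (x : ∀ i, κ i → F i) (i : ι) :
    hammingNorm (monomialEquiv σ u x i) = hammingNorm (x i) := by
  refine Finset.card_equiv (σ i) fun j => ?_
  simp [monomialEquiv_apply]

/-- The Fourier transform of the function that is `1` at `0` and `z` elsewhere. -/
theorem sum_ite_mul_addChar {K : Type*} [Field K] [Fintype K] [DecidableEq K]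
    {ψ : AddChar K ℂ} (hψ : ∃ x, ψ x ≠ 1) (z : ℂ) (a : K) :
    ∑ y, (if y ≠ 0 then z else 1) * ψ (a * y)
      = (1 - z) + z * (if a = 0 then (Fintype.card K : ℂ) else 0) := by
  have hprim : ψ.IsPrimitive := AddChar.IsPrimitive.of_ne_one (AddChar.ne_one_iff.2 hψ)
  have hterm : ∀ y : K, (if y ≠ 0 then z else 1) * ψ (a * y)
      = (if y = 0 then 1 - z else 0) + z * ψ (y * a) := by
    intro y
    by_cases hy : y = 0
    · simp [hy]
    · simp [hy, mul_comm]
  simp_rw [hterm]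
  rw [Finset.sum_add_distrib, ← Finset.mul_sum, AddChar.sum_mulShift a hprim]
  simp

/-- A sum over a product of function spaces of a product of local terms factors. -/
theorem sum_prod_prod_eq_prod_prod_sum {ι : Type*} [Fintype ι] [DecidableEq ι]
    {κ : ι → Type*} [∀ i, Fintype (κ i)] [∀ i, DecidableEq (κ i)]
    {F : ι → Type*} [∀ i, Fintype (F i)] (f : ∀ i, κ i → F i → ℂ) :
    ∑ x : ∀ i, κ i → F i, ∏ i, ∏ j, f i j (x i j) = ∏ i, ∏ j, ∑ y, f i j y := by
  simp_rw [Fintype.prod_sum]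

/-- The Fourier transform of the product of the `z i ^ hammingNorm (x i)`. -/
theorem sum_prod_pow_hammingNorm_mul_addChar {ι : Type*} [Fintype ι] [DecidableEq ι]
    {κ : ι → Type*} [∀ i, Fintype (κ i)] [∀ i, DecidableEq (κ i)]
    {F : ι → Type*} [∀ i, Field (F i)] [∀ i, Fintype (F i)] [∀ i, DecidableEq (F i)]
    {χ : ∀ i, AddChar (F i) ℂ} (hχ : ∀ i, ∃ x, χ i x ≠ 1) (z : ι → ℂ) (a : ∀ i, κ i → F i) :
    ∑ x : ∀ i, κ i → F i, (∏ i, z i ^ hammingNorm (x i)) * ∏ i, ∏ j, χ i (a i j * x i j)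
      = ∏ i, ∏ j, ((1 - z i) + z i * (if a i j = 0 then (Fintype.card (F i) : ℂ) else 0)) := by
  simp_rw [← sum_ite_mul_addChar (hχ _)]
  rw [← sum_prod_prod_eq_prod_prod_sum
    (fun i j y => (if y ≠ 0 then z i else 1) * χ i (a i j * y))]
  refine Finset.sum_congr rfl fun x _ => ?_
  simp_rw [Finset.prod_mul_distrib]
  congr 1
  refine Finset.prod_congr rfl fun i _ => ?_
  rw [Finset.prod_ite, Finset.prod_const, Finset.prod_const_one, mul_one]
  rfl

/-- Let `q i` be distinct prime powers with `[(q i, n i)]` separating,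
`F i` finite fields with `|F i| = q i`, and `R = ∏ i (F i)^{n i}`.  Let
`ω(a) = 1 − ∏ i (−1/(q_i−1))^{wt(a_i)}` be the normalized homogeneous weight and `χ` the
product of nontrivial additive characters `χ i` of `F i`.  Then the homogeneous weight
partition is self-dual: `ω a = ω b` iff for every `c ∈ ℝ`,
`Σ_{x : ω x = c} χ(a·x) = Σ_{x : ω x = c} χ(b·x)`. -/
theorem homWeight_partition_selfDual_semisimple {t : ℕ} {n : Fin t → ℕ}
    (F : Fin t → Type*) [∀ i, Field (F i)] [∀ i, Fintype (F i)] [∀ i, DecidableEq (F i)]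
    (q : Fin t → ℕ) (hqpp : ∀ i, IsPrimePow (q i)) (hqdist : Function.Injective q)
    (hcard : ∀ i, Fintype.card (F i) = q i)
    (hsep : SeparatingList q n)
    (χ : ∀ i, AddChar (F i) ℂ) (hχ : ∀ i, ∃ x : F i, χ i x ≠ 1)
    (ω : (∀ i, Fin (n i) → F i) → ℝ)
    (hω : ∀ a : ∀ i, Fin (n i) → F i,
      ω a = 1 - ∏ i,
        (-1 / ((q i : ℝ) - 1)) ^ (Finset.univ.filter (fun j => a i j ≠ 0)).card) :
    ∀ a b : ∀ i, Fin (n i) → F i,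
      ω a = ω b ↔
        ∀ c : ℝ,
          ∑ x ∈ Finset.univ.filter (fun x : ∀ i, Fin (n i) → F i => ω x = c),
            ∏ i, ∏ j, χ i (a i j * x i j)
          = ∑ x ∈ Finset.univ.filter (fun x : ∀ i, Fin (n i) → F i => ω x = c),
            ∏ i, ∏ j, χ i (b i j * x i j) := by
  classical
  have hq : ∀ i, 2 ≤ q i := fun i => (hqpp i).two_le
  have hwle : ∀ (a : ∀ i, Fin (n i) → F i) i, hammingNorm (a i) ≤ n i := fun a i =>
    hammingNorm_le_card_fintype.trans (Fintype.card_fin _).le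
  have hω' : ∀ a, ω a = 1 - ∏ i, (-1 / ((q i : ℝ) - 1)) ^ hammingNorm (a i) := hω
  have hωiff : ∀ a b, ω a = ω b ↔ ∀ i, hammingNorm (a i) = hammingNorm (b i) := by
    intro a b
    rw [hω', hω', sub_right_inj]
    exact ⟨fun h => congrFun (hsep.eq_of_prod_eq hq (hwle a) (hwle b) h),
      fun h => by simp_rw [h]⟩
  intro a b
  rw [hωiff]
  constructor
  · intro h c
    choose σ u hσ using fun i => exists_perm_units_of_hammingNorm_eq (h i)
    symm
    refine Finset.sum_equiv (monomialEquiv σ u) (fun x => ?_) fun x _ => ?_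
    · rw [Finset.mem_filter, Finset.mem_filter,
        (hωiff (monomialEquiv σ u x) x).2 (hammingNorm_monomialEquiv σ u x)]
      simp
    · refine Finset.prod_congr rfl fun i _ => ?_
      rw [← Equiv.prod_comp (σ i)]
      refine Finset.prod_congr rfl fun j _ => ?_
      rw [hσ, monomialEquiv_apply, mul_assoc]
  · intro h i₀
    let z : Fin t → ℂ := Pi.single i₀ (1 / 2)
    have hfac : Function.FactorsThrough
        (fun x : ∀ i, Fin (n i) → F i => ∏ i, z i ^ hammingNorm (x i)) ω := fun x y hxy =>
      Finset.prod_congr rfl fun i _ => by rw [(hωiff x y).1 hxy i]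
    obtain ⟨g, hg⟩ := (Function.factorsThrough_iff _).1 hfac
    have hsum : ∀ a : ∀ i, Fin (n i) → F i,
        ∑ x : ∀ i, Fin (n i) → F i, (∏ i, z i ^ hammingNorm (x i)) *
            ∏ i, ∏ j, χ i (a i j * x i j)
          = ∑ c ∈ Finset.univ.image ω, g c *
            ∑ x ∈ Finset.univ.filter (fun x : ∀ i, Fin (n i) → F i => ω x = c),
              ∏ i, ∏ j, χ i (a i j * x i j) := by
      intro a
      rw [← Finset.sum_fiberwise_of_maps_to (g := ω) (t := Finset.univ.image ω)
        (fun x hx => Finset.mem_image_of_mem ω hx)]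
      refine Finset.sum_congr rfl fun c _ => ?_
      rw [Finset.mul_sum]
      refine Finset.sum_congr rfl fun x hx => ?_
      rw [← (Finset.mem_filter.1 hx).2]
      exact congrArg (· * _) (congrFun hg x)
    have hloc : ∀ a : ∀ i, Fin (n i) → F i,
        ∏ i, ∏ j, ((1 - z i) + z i * (if a i j = 0 then (Fintype.card (F i) : ℂ) else 0))
          = (1 / 2) ^ n i₀ *
            (((1 + q i₀) ^ (Finset.univ.filter fun j => a i₀ j = 0).card : ℕ) : ℂ) := by
      intro a
      rw [Finset.prod_eq_single i₀ (fun i _ hi => by simp [z, hi]) (by simp)]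
      have hterm : ∀ j, (1 - z i₀) + z i₀ * (if a i₀ j = 0 then (Fintype.card (F i₀) : ℂ) else 0)
          = 1 / 2 * (if a i₀ j = 0 then 1 + (q i₀ : ℂ) else 1) := by
        intro j
        simp only [z, Pi.single_eq_same, hcard]
        split_ifs <;> ring
      simp_rw [hterm]
      rw [Finset.prod_mul_distrib, Finset.prod_ite]
      simp
    have heq := (sum_prod_pow_hammingNorm_mul_addChar hχ z a).symm.trans
      (((hsum a).trans ((Finset.sum_congr rfl fun c _ => by rw [h c]).trans
        (hsum b).symm)).trans (sum_prod_pow_hammingNorm_mul_addChar hχ z b))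
    rw [hloc, hloc, mul_right_inj' (pow_ne_zero _ (by norm_num)), Nat.cast_inj] at heq
    have hzeros := Nat.pow_right_injective (by have := hq i₀; omega) heq
    have hcompl : ∀ a : ∀ i, Fin (n i) → F i,
        (Finset.univ.filter fun j => a i₀ j = 0).card + hammingNorm (a i₀) = n i₀ := fun a => by
      simpa [hammingNorm] using
        Finset.card_filter_add_card_filter_not (s := Finset.univ) (fun j => a i₀ j = 0)
    have ha := hcompl a
    have hb := hcompl b
    omega
end
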